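/- arXiv:2207.12905 — 11 statements merged into one kernel-verified Lean document; each statement's English description precedes it below -/
import Mathlib

section
/- Let X be a σ-compact locally compact Hausdorff topological space, let A be a closed subset of X, and let f : A → [0, ∞) be a continuous proper function (i.e., the preimage of every compact subset of [0, ∞) is compact). Then there exists a continuous proper function F : X → [0, ∞) such that F restricted to A equals f. -/
/-- A nonnegative proper function `f` on a closed subset `A` of a σ-compact locally compact Hausdorff
space dominates on `A` some nonnegative continuous function on the whole space, all of whose
sublevel sets are contained in compact sets. -/
theorem exists_continuous_le_of_proper
    {X : Type*} [TopologicalSpace X] [T2Space X] [SigmaCompactSpace X] [LocallyCompactSpace X]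
    {A : Set X} {f : A → ℝ} (hf0 : ∀ a, 0 ≤ f a)
    (hfp : ∀ K : Set ℝ, IsCompact K → IsCompact (f ⁻¹' K)) :
    ∃ q : C(X, ℝ), (∀ x, 0 ≤ q x) ∧ (∀ a : A, q a ≤ f a) ∧
      ∀ n : ℕ, ∃ K : Set X, IsCompact K ∧ ∀ x, q x < n → x ∈ K := by
  let K : CompactExhaustion X := CompactExhaustion.choice X
  have hcov : ∀ n : ℕ, ∃ m, Subtype.val '' (f ⁻¹' Set.Icc 0 (n + 1 : ℝ)) ⊆ K m := fun n =>
    K.exists_superset_of_isCompact ((hfp _ isCompact_Icc).image continuous_subtype_val)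
  choose m hm using hcov
  let M : ℕ → ℕ := fun n => ∑ i ∈ Finset.range (n + 1), (m i + 1)
  have hM : StrictMono M := strictMono_nat_of_lt_succ fun n => by
    simp only [M, Finset.sum_range_succ _ (n + 1)]
    omega
  have hmM : ∀ n, m n ≤ M n := fun n => by
    simp only [M, Finset.sum_range_succ]
    omega
  have hlt : ∀ (n : ℕ) (a : A), (a : X) ∉ K (M n) → (n + 1 : ℝ) < f a := by
    intro n a ha
    by_contra! h
    exact ha (K.subset (hmM n) (hm n ⟨a, ⟨hf0 a, h⟩, rfl⟩))
  have hex : ∀ x : X, ∃ n, x ∈ K (M n) := fun x =>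
    (K.exists_mem x).imp fun n hn => K.subset (hM.le_apply) hn
  let t : X → Set ℝ := fun y =>
    {c | 0 ≤ c ∧ (∀ h : y ∈ A, c ≤ f ⟨y, h⟩) ∧ ∀ n : ℕ, y ∉ K (M n) → (n : ℝ) ≤ c}
  have ht : ∀ x, Convex ℝ (t x) := by
    intro x
    refine Set.OrdConnected.convex ⟨fun a ha b hb c hc => ?_⟩
    exact ⟨ha.1.trans hc.1, fun h => hc.2.trans (hb.2.1 h),
      fun n hn => (ha.2.2 n hn).trans hc.1⟩
  have hloc : ∀ x : X, ∃ c : ℝ, ∀ᶠ y in nhds x, c ∈ t y := by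
    intro x
    classical
    obtain ⟨N, hN, hmin⟩ : ∃ N, x ∈ K (M N) ∧ ∀ k < N, x ∉ K (M k) :=
      ⟨Nat.find (hex x), Nat.find_spec (hex x), fun k hk => Nat.find_min (hex x) hk⟩
    have hnear : ∀ᶠ y in nhds x, y ∈ K (M (N + 1)) :=
      mem_interior_iff_mem_nhds.1 (K.subset_interior (hM N.lt_succ_self) hN)
    have hle : ∀ᶠ y in nhds x, ∀ h : y ∈ A, (N : ℝ) ≤ f ⟨y, h⟩ := by
      rcases N with _ | k
      · exact Filter.Eventually.of_forall fun y h => by simpa using hf0 ⟨y, h⟩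
      · filter_upwards [(K.isClosed (M k)).isOpen_compl.mem_nhds (hmin k k.lt_succ_self)]
          with y hy h
        simpa using (hlt k ⟨y, h⟩ hy).le
    refine ⟨N, ?_⟩
    filter_upwards [hnear, hle] with y hy hyA
    refine ⟨N.cast_nonneg, hyA, fun n hn => ?_⟩
    by_contra! h
    exact hn (K.subset (hM.monotone (Nat.succ_le_of_lt (by exact_mod_cast h))) hy)
  obtain ⟨q, hq⟩ := exists_continuous_forall_mem_convex_of_local_const ht hloc
  refine ⟨q, fun x => (hq x).1, fun a => (hq a).2.1 a.2, fun n => ⟨K (M n), K.isCompact _, ?_⟩⟩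
  intro x hx
  by_contra h
  exact hx.not_ge ((hq x).2.2 n h)

/-- **Tietze–Urysohn for proper functions.**
Let `X` be a σ-compact locally compact Hausdorff space, `A` a closed subset,
and `f : A → [0, ∞)` a continuous proper function. Then there is a continuous
proper function `F : X → [0, ∞)` with `F|_A = f`. -/
theorem proper_tietze_urysohn
    {X : Type*} [TopologicalSpace X] [T2Space X]
    [SigmaCompactSpace X] [LocallyCompactSpace X]
    (A : Set X) (hA : IsClosed A)
    (f : A → ℝ) (hf0 : ∀ a, 0 ≤ f a) (hfc : Continuous f)
    (hfp : ∀ K : Set ℝ, IsCompact K → IsCompact (f ⁻¹' K)) :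
    ∃ F : X → ℝ, (∀ x, 0 ≤ F x) ∧ Continuous F ∧
      (∀ K : Set ℝ, IsCompact K → IsCompact (F ⁻¹' K)) ∧
      ∀ a : A, F a = f a := by
  obtain ⟨q, hq0, hqf, hqK⟩ := exists_continuous_le_of_proper hf0 hfp
  obtain ⟨g, hg⟩ := ContinuousMap.exists_restrict_eq hA (⟨f, hfc⟩ : C(A, ℝ))
  have hcont : Continuous fun x => max (q x) (g x) := q.continuous.max g.continuous
  refine ⟨fun x => max (q x) (g x), fun x => (hq0 x).trans (le_max_left _ _), hcont, ?_, ?_⟩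
  · intro K hK
    obtain ⟨b, hb⟩ := hK.bddAbove
    obtain ⟨n, hn⟩ := exists_nat_gt b
    obtain ⟨L, hL, hqL⟩ := hqK n
    exact hL.of_isClosed_subset (hK.isClosed.preimage hcont) fun x hx =>
      hqL x ((le_max_left _ _).trans_lt ((hb hx).trans_lt hn))
  · intro a
    have hga : g a = f a := DFunLike.congr_fun hg a
    simpa [hga] using hqf a
end

section
/- Let X be a σ-compact locally compact metrizable topological space and let A be a closed subset of X. For every proper metric d on A that generates the subspace topology of A, there exists a proper metric D on X generating the topology of X such that the restriction of D to A × A equals d. -/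
/-- A metric (given as a distance function) on a topological space that generates
its topology: it satisfies the metric axioms, and a set is open iff it contains an
open `d`-ball around each of its points. -/
def IsMetricGen {X : Type*} [TopologicalSpace X] (d : X → X → ℝ) : Prop :=
  (∀ x y, 0 ≤ d x y) ∧
  (∀ x y, d x y = 0 ↔ x = y) ∧
  (∀ x y, d x y = d y x) ∧
  (∀ x y z, d x z ≤ d x y + d y z) ∧
  (∀ s : Set X, IsOpen s ↔ ∀ x ∈ s, ∃ ε > 0, ∀ y, d x y < ε → y ∈ s)

/-- A metric is proper if every bounded closed subset is compact. -/
def IsProperMetric {X : Type*} [TopologicalSpace X] (d : X → X → ℝ) : Prop :=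
  ∀ s : Set X, IsClosed s → (∃ C, ∀ x ∈ s, ∀ y ∈ s, d x y ≤ C) → IsCompact s

open Set Filter Topology

/-- A continuous map on a closed subspace, with values in a convex set `S`, is approximated by the
restriction of a continuous map on the whole space with values in `S`. -/
theorem exists_continuousMap_mem_dist_lt {B X E : Type*} [TopologicalSpace B]
    [TopologicalSpace X] [NormalSpace X] [ParacompactSpace X]
    [NormedAddCommGroup E] [NormedSpace ℝ E]
    {i : B → X} (hi : IsClosedEmbedding i) (g : C(B, E)) {S : Set E} (hS : Convex ℝ S)
    (hne : S.Nonempty) (hgS : ∀ b, g b ∈ S) {ε : ℝ} (hε : 0 < ε) :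
    ∃ f : C(X, E), ∀ x, f x ∈ S ∧ ∀ b, i b = x → dist (f x) (g b) < ε := by
  refine exists_continuous_forall_mem_convex_of_local_const
    (t := fun x => {y | y ∈ S ∧ ∀ b, i b = x → dist y (g b) < ε}) (fun x => ?_) (fun x => ?_)
  · have : {y | y ∈ S ∧ ∀ b, i b = x → dist y (g b) < ε}
        = S ∩ ⋂ b, ⋂ _ : i b = x, Metric.ball (g b) ε := by
      ext y; simp
    rw [this]
    exact hS.inter (convex_iInter₂ fun b _ => convex_ball _ _)
  · by_cases hx : x ∈ range i
    · obtain ⟨b, rfl⟩ := hx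
      refine ⟨g b, ?_⟩
      have h : ∀ᶠ b' in comap i (𝓝 (i b)), dist (g b') (g b) < ε := by
        rw [← hi.isInducing.nhds_eq_comap]
        exact g.continuous.continuousAt.eventually (Metric.ball_mem_nhds _ hε)
      filter_upwards [eventually_comap.1 h] with y hy
      exact ⟨hgS b, fun b' hb' => by rw [dist_comm]; exact hy b' hb'⟩
    · obtain ⟨c, hc⟩ := hne
      refine ⟨c, ?_⟩
      filter_upwards [hi.isClosed_range.isOpen_compl.mem_nhds hx] with y hy
      exact ⟨hc, fun b hb => (hy ⟨b, hb⟩).elim⟩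

/-- The Tietze extension theorem for maps with values in a Banach space. -/
theorem exists_continuousMap_extension {B X E : Type*} [TopologicalSpace B]
    [TopologicalSpace X] [NormalSpace X] [ParacompactSpace X]
    [NormedAddCommGroup E] [NormedSpace ℝ E] [CompleteSpace E]
    {i : B → X} (hi : IsClosedEmbedding i) (g : C(B, E)) :
    ∃ f : C(X, E), ∀ b, f (i b) = g b := by
  obtain ⟨F₀, hF₀⟩ := exists_continuousMap_mem_dist_lt hi g convex_univ univ_nonempty
    (fun _ => mem_univ _) one_pos
  have step : ∀ (n : ℕ) (F : C(X, E)), (∀ b, dist (F (i b)) (g b) ≤ 1 / 2 ^ n) →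
      ∃ F' : C(X, E), (∀ b, dist (F' (i b)) (g b) ≤ 1 / 2 ^ (n + 1)) ∧
        ∀ x, dist (F x) (F' x) ≤ 1 / 2 ^ n := by
    intro n F hF
    obtain ⟨f, hf⟩ := exists_continuousMap_mem_dist_lt hi (g - F.comp ⟨i, hi.continuous⟩)
      (convex_closedBall (0 : E) (1 / 2 ^ n)) ⟨0, by simp⟩
      (fun b => by
        have := hF b
        rw [dist_comm, dist_eq_norm] at this
        simpa using this) (ε := 1 / 2 ^ (n + 1)) (by positivity)
    refine ⟨F + f, fun b => ?_, fun x => ?_⟩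
    · have := ((hf (i b)).2 b rfl).le
      rw [dist_eq_norm] at this ⊢
      rwa [show (F + f) (i b) - g b = f (i b) - (g b - F (i b)) by
        rw [ContinuousMap.add_apply]; abel]
    · have := (hf x).1
      simpa [dist_eq_norm] using this
  choose! F_next h₁ h₂ using step
  let F : ℕ → C(X, E) := fun n => Nat.rec F₀ F_next n
  have hF : ∀ n b, dist (F n (i b)) (g b) ≤ 1 / 2 ^ n := by
    intro n
    induction n with
    | zero =>
      intro b
      rw [pow_zero, div_one]
      exact ((hF₀ (i b)).2 b rfl).le
    | succ n ih => exact h₁ n _ ih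
  have hFF : ∀ x n, dist (F n x) (F (n + 1) x) ≤ 2 / 2 / 2 ^ n := by
    intro x n
    have := h₂ n _ (hF n) x
    norm_num at this ⊢
    exact this
  choose f hf using fun x => cauchySeq_tendsto_of_complete (cauchySeq_of_le_geometric_two (hFF x))
  have hpow : Tendsto (fun n : ℕ => (2 : ℝ) / 2 ^ n) atTop (𝓝 0) :=
    tendsto_const_nhds.div_atTop (tendsto_pow_atTop_atTop_of_one_lt one_lt_two)
  have hu : TendstoUniformly (fun n x => F n x) f atTop := by
    rw [Metric.tendstoUniformly_iff]
    intro ε hε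
    filter_upwards [hpow.eventually (gt_mem_nhds hε)] with n hn x
    rw [dist_comm]
    exact (dist_le_of_le_geometric_two_of_tendsto (hFF x) (hf x) n).trans_lt hn
  refine ⟨⟨f, hu.continuous (.of_forall fun n => (F n).continuous)⟩, fun b => ?_⟩
  refine tendsto_nhds_unique (hf (i b)) ?_
  rw [tendsto_iff_dist_tendsto_zero]
  refine squeeze_zero (fun _ => dist_nonneg) (fun n => (hF n b).trans ?_) hpow
  gcongr
  exact one_le_two

/-- A σ-compact locally compact paracompact space carries a continuous real function whose
sublevel sets lie in compact sets. -/
theorem exists_continuousMap_sublevel_subset_isCompact (X : Type*) [TopologicalSpace X]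
    [NormalSpace X] [ParacompactSpace X] [SigmaCompactSpace X] [WeaklyLocallyCompactSpace X] :
    ∃ h : C(X, ℝ), ∀ C : ℝ, ∃ K : Set X, IsCompact K ∧ ∀ x, h x ≤ C → x ∈ K := by
  let K := CompactExhaustion.choice X
  obtain ⟨h, hh⟩ := exists_continuous_forall_mem_convex_of_local_const
    (t := fun x => Ici (K.find x : ℝ)) (fun x => convex_Ici _) (fun x => by
      obtain ⟨n, hn⟩ := K.exists_mem_nhds x
      refine ⟨n, ?_⟩
      filter_upwards [hn] with y hy
      exact mem_Ici.2 (Nat.cast_le.2 (K.mem_iff_find_le.1 hy)))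
  refine ⟨h, fun C => ⟨K ⌈C⌉₊, K.isCompact _, fun x hx => K.mem_iff_find_le.2 ?_⟩⟩
  exact_mod_cast ((mem_Ici.1 (hh x)).trans hx).trans (Nat.le_ceil C)

/-- On a proper metric space, a continuous real function is bounded by a continuous function of
the distance to a given point. -/
theorem exists_continuousMap_le_comp_dist {B : Type*} [PseudoMetricSpace B] [ProperSpace B]
    {φ : B → ℝ} (hφ : Continuous φ) (b₀ : B) : ∃ w : C(ℝ, ℝ), ∀ b, φ b ≤ w (dist b b₀) := by
  obtain ⟨w, hw⟩ := exists_continuous_forall_mem_convex_of_local_const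
    (t := fun r : ℝ => ⋂ b, ⋂ _ : dist b b₀ = r, Ici (φ b))
    (fun r => convex_iInter₂ fun b _ => convex_Ici _) (fun r => by
      obtain ⟨c, hc⟩ := (isCompact_closedBall b₀ (r + 1)).bddAbove_image hφ.continuousOn
      refine ⟨c, ?_⟩
      filter_upwards [gt_mem_nhds (lt_add_one r)] with s hs
      simp only [mem_iInter, mem_Ici]
      exact fun b hb => hc ⟨b, by simpa [hb] using hs.le, rfl⟩)
  refine ⟨w, fun b => ?_⟩
  have := hw (dist b b₀)
  simp only [mem_iInter, mem_Ici] at this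
  exact this b rfl

/-- The distance induced by an embedding generates the topology. -/
theorem isMetricGen_dist_comp {X Y : Type*} [TopologicalSpace X] [MetricSpace Y] {Φ : X → Y}
    (hΦ : IsEmbedding Φ) : IsMetricGen fun x y => dist (Φ x) (Φ y) := by
  refine ⟨fun _ _ => dist_nonneg, fun _ _ => dist_eq_zero.trans hΦ.injective.eq_iff,
    fun _ _ => dist_comm _ _, fun _ _ _ => dist_triangle _ _ _, fun s => ?_⟩
  let := hΦ.comapMetricSpace
  rw [Metric.isOpen_iff]
  refine forall₂_congr fun x _ => exists_congr fun ε => and_congr_right fun _ => ?_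
  refine forall_congr' fun y => ?_
  rw [Metric.mem_ball, dist_comm]
  rfl

/-- A continuous injection into a metric space under which closed balls have relatively compact
preimages is a closed embedding. -/
theorem isClosedEmbedding_of_preimage_closedBall_subset {X Y : Type*} [TopologicalSpace X]
    [MetricSpace Y] {Φ : X → Y} (hc : Continuous Φ) (hinj : Function.Injective Φ)
    (hb : ∀ y r, ∃ K : Set X, IsCompact K ∧ Φ ⁻¹' Metric.closedBall y r ⊆ K) :
    IsClosedEmbedding Φ := by
  refine .of_continuous_injective_isClosedMap hc hinj (IsProperMap.isClosedMap ?_)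
  refine isProperMap_iff_isCompact_preimage.2 ⟨hc, fun L hL => ?_⟩
  rcases L.eq_empty_or_nonempty with rfl | ⟨y, -⟩
  · simp
  obtain ⟨r, hr⟩ := hL.isBounded.subset_closedBall y
  obtain ⟨K, hK, hsub⟩ := hb y r
  exact hK.of_isClosed_subset (hL.isClosed.preimage hc) ((preimage_mono hr).trans hsub)

/-- A closed embedding of a nonempty proper metric space into a σ-compact locally compact
metrizable space becomes isometric for a suitable proper metric on the target. -/
theorem exists_properMetric_extension {B X : Type*} [MetricSpace B] [ProperSpace B] [Nonempty B]
    [TopologicalSpace X] [TopologicalSpace.MetrizableSpace X]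
    [SigmaCompactSpace X] [WeaklyLocallyCompactSpace X] {i : B → X} (hi : IsClosedEmbedding i) :
    ∃ D : X → X → ℝ, IsMetricGen D ∧ IsProperMetric D ∧ ∀ a b, D (i a) (i b) = dist a b := by
  let := TopologicalSpace.metrizableSpaceMetric X
  obtain ⟨b₀⟩ := ‹Nonempty B›
  have hκ := kuratowskiEmbedding.isometry B
  have hk := kuratowskiEmbedding.isometry X
  obtain ⟨f, hf⟩ := exists_continuousMap_extension hi ⟨_, hκ.continuous⟩
  simp only [ContinuousMap.coe_mk] at hf
  obtain ⟨h, hh⟩ := exists_continuousMap_sublevel_subset_isCompact X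
  obtain ⟨w, hw⟩ := exists_continuousMap_le_comp_dist (h.continuous.comp hi.continuous) b₀
  let v : X → ℝ := fun x => max 0 (h x - w (dist (f x) (f (i b₀))))
  let u : X → ℝ := fun x => Metric.infDist x (range i)
  have hu : ∀ x, u x = 0 ↔ x ∈ range i := fun x =>
    (hi.isClosed_range.mem_iff_infDist_zero ⟨_, mem_range_self b₀⟩).symm
  have hui : ∀ b, u (i b) = 0 := fun b => (hu _).2 (mem_range_self b)
  have hvi : ∀ b, v (i b) = 0 := fun b => by
    have := hw b
    simp only [v, hf, hκ.dist_eq]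
    exact max_eq_left (sub_nonpos.2 this)
  let Φ := fun x => (f x, v x, u x, u x • kuratowskiEmbedding X x)
  have huc : Continuous u := Metric.continuous_infDist_pt _
  have hvc : Continuous v := by fun_prop
  have hkc := hk.continuous
  have hΦc : Continuous Φ := by fun_prop
  have hinj : Function.Injective Φ := by
    intro x y hxy
    simp only [Φ, Prod.mk.injEq] at hxy
    obtain ⟨h₁, -, h₃, h₄⟩ := hxy
    by_cases hx : u x = 0
    · obtain ⟨a, rfl⟩ := (hu x).1 hx
      obtain ⟨b, rfl⟩ := (hu y).1 (h₃ ▸ hx)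
      rw [hf, hf] at h₁
      rw [hκ.injective h₁]
    · rw [← h₃] at h₄
      exact hk.injective (smul_right_injective _ hx h₄)
  have hΦ : ∀ y r, ∃ K : Set X, IsCompact K ∧ Φ ⁻¹' Metric.closedBall y r ⊆ K := by
    intro y r
    obtain ⟨c, hc⟩ := (isCompact_Icc (a := (0 : ℝ)) (b := r + dist y.1 (f (i b₀)))).bddAbove_image
      w.continuous.continuousOn
    obtain ⟨K, hK, hsub⟩ := hh (y.2.1 + r + c)
    refine ⟨K, hK, fun x hx => hsub x ?_⟩
    simp only [Φ, mem_preimage, Metric.mem_closedBall, Prod.dist_eq, max_le_iff] at hx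
    have h₁ := hc ⟨dist (f x) (f (i b₀)), ⟨dist_nonneg,
      (dist_triangle _ y.1 _).trans (by gcongr; exact hx.1)⟩, rfl⟩
    have h₂ := (abs_le.1 (Real.dist_eq _ _ ▸ hx.2.1)).2
    have h₃ : h x - w (dist (f x) (f (i b₀))) ≤ v x := le_max_right _ _
    linarith
  refine ⟨fun x y => dist (Φ x) (Φ y), isMetricGen_dist_comp
    (isClosedEmbedding_of_preimage_closedBall_subset hΦc hinj hΦ).isEmbedding, ?_, fun a b => ?_⟩
  · rintro s hs ⟨C, hC⟩
    rcases s.eq_empty_or_nonempty with rfl | ⟨x, hx⟩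
    · exact isCompact_empty
    obtain ⟨K, hK, hsub⟩ := hΦ (Φ x) C
    exact hK.of_isClosed_subset hs fun y hy => hsub (hC y hy x hx)
  · simp [Φ, Prod.dist_eq, hui, hvi, hf, hκ.dist_eq]

/-- **Extension of proper metrics.** Let `X` be a σ-compact locally compact
metrizable space and `A` a closed subset. Every proper metric `d` on `A` generating
the subspace topology extends to a proper metric `D` on `X` generating the topology
of `X` with `D|_{A×A} = d`. -/
theorem extend_proper_metric
    {X : Type*} [TopologicalSpace X] [TopologicalSpace.MetrizableSpace X]
    [SigmaCompactSpace X] [LocallyCompactSpace X]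
    (A : Set X) (hA : IsClosed A)
    (d : A → A → ℝ) (hd : IsMetricGen d) (hdp : IsProperMetric d) :
    ∃ D : X → X → ℝ, IsMetricGen D ∧ IsProperMetric D ∧
      ∀ a b : A, D a b = d a b := by
  rcases A.eq_empty_or_nonempty with rfl | hne
  · rcases isEmpty_or_nonempty X with hX | ⟨⟨x⟩⟩
    · refine ⟨fun _ _ => 0, ⟨isEmptyElim, isEmptyElim, isEmptyElim, isEmptyElim, fun s => ?_⟩,
        fun s _ _ => ?_, fun a => a.2.elim⟩
      · simp [Set.eq_empty_of_isEmpty s]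
      · simp [Set.eq_empty_of_isEmpty s]
    · obtain ⟨D, hD, hDp, -⟩ := exists_properMetric_extension (i := fun _ : Unit => x)
        (.of_continuous_injective_isClosedMap continuous_const (Function.injective_of_subsingleton _)
          continuous_const.isClosedMap)
      exact ⟨D, hD, hDp, fun a => a.2.elim⟩
  · obtain ⟨-, h₀, hsymm, htri, hopen⟩ := hd
    let : MetricSpace A := .ofDistTopology d (fun x => (h₀ x x).2 rfl) hsymm htri hopen
      fun x y => (h₀ x y).1
    have : Nonempty A := hne.to_subtype
    have : ProperSpace A := ⟨fun x r => hdp _ Metric.isClosed_closedBall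
      ⟨r + r, fun y hy z hz => (dist_triangle_right y z x).trans (add_le_add hy hz)⟩⟩
    exact exists_properMetric_extension hA.isClosedEmbedding_subtypeVal
end

section
/- Let X be a strongly 0-dimensional, σ-compact, locally compact metrizable topological space and let A be a non-empty non-compact closed subset of X. Then A is a proper retract of X, i.e., there exists a continuous map r : X → A with r(a) = a for all a ∈ A such that the preimage under r of every compact subset of A is compact. -/
/-- A topological space is strongly 0-dimensional if every pair of disjoint
closed sets can be separated by a clopen set. -/
def StronglyZeroDimensional (X : Type*) [TopologicalSpace X] : Prop :=
  ∀ A B : Set X, IsClosed A → IsClosed B → Disjoint A B →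
    ∃ V : Set X, IsClopen V ∧ A ⊆ V ∧ Disjoint V B

open Set Filter Topology

/-- The least index `n` with `x ∈ V n` (and `0` if there is none). -/
noncomputable def firstIndex {X : Type*} (V : ℕ → Set X) (x : X) : ℕ :=
  sInf {n | x ∈ V n}

theorem mem_firstIndex {X : Type*} {V : ℕ → Set X} {x : X} (hx : x ∈ ⋃ n, V n) :
    x ∈ V (firstIndex V x) :=
  Nat.sInf_mem (s := {n | x ∈ V n}) (mem_iUnion.1 hx)

theorem eventually_firstIndex_eq {X : Type*} [TopologicalSpace X] {V : ℕ → Set X}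
    (hV : ∀ n, IsClopen (V n)) {x : X} (hx : x ∈ ⋃ n, V n) :
    ∀ᶠ y in 𝓝 x, y ∈ V (firstIndex V x) ∧ firstIndex V y = firstIndex V x := by
  have hmem := mem_firstIndex hx
  have hlt : ∀ᶠ y in 𝓝 x, ∀ m ∈ Iio (firstIndex V x), y ∉ V m :=
    (eventually_all_finite (finite_Iio _)).2 fun m hm =>
      (hV m).compl.isOpen.mem_nhds (Nat.notMem_of_lt_sInf (s := {n | x ∈ V n}) hm)
  filter_upwards [(hV _).isOpen.mem_nhds hmem, hlt] with y hy hy'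
  refine ⟨hy, le_antisymm (Nat.sInf_le hy) ?_⟩
  by_contra! h
  exact hy' _ h (mem_firstIndex (mem_iUnion.2 ⟨_, hy⟩))

/-- A strongly zero-dimensional second countable metrizable space retracts continuously onto each
of its non-empty closed subsets. -/
theorem StronglyZeroDimensional.exists_retraction {X : Type*} [TopologicalSpace X]
    [TopologicalSpace.MetrizableSpace X] [SecondCountableTopology X]
    (hX : StronglyZeroDimensional X) {A : Set X} (hA : IsClosed A) (hne : A.Nonempty) :
    ∃ r : X → A, Continuous r ∧ ∀ a : A, r a = a := by
  classical
  let _ := TopologicalSpace.metrizableSpaceMetric X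
  have key : ∀ x : X, ∃ V : Set X, ∃ a : A, IsClopen V ∧ (x ∉ A → x ∈ V) ∧
      ∀ y ∈ V, dist y a < 3 * Metric.infDist y A := by
    intro x
    by_cases hx : x ∈ A
    · exact ⟨∅, ⟨x, hx⟩, isClopen_empty, fun h => absurd hx h, by simp⟩
    · have hpos : 0 < Metric.infDist x A := (hA.notMem_iff_infDist_pos hne).1 hx
      obtain ⟨a, haA, ha⟩ := (Metric.infDist_lt_iff (r := 3 * Metric.infDist x A) hne).1
        (by linarith)
      have hU : IsOpen {y | dist y a < 3 * Metric.infDist y A} :=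
        isOpen_lt (by fun_prop) ((Metric.continuous_infDist_pt A).const_mul 3)
      obtain ⟨V, hV, hxV, hVU⟩ := hX {x} {y | dist y a < 3 * Metric.infDist y A}ᶜ
        isClosed_singleton hU.isClosed_compl (disjoint_singleton_left.2 (fun h => h ha))
      exact ⟨V, ⟨a, haA⟩, hV, fun _ => hxV rfl,
        fun y hy => disjoint_compl_right_iff_subset.1 hVU hy⟩
  choose V c hV hxV hVc using key
  obtain ⟨T, hT, hTV⟩ := TopologicalSpace.isOpen_iUnion_countable V fun x => (hV x).isOpen
  have : Nonempty X := ⟨hne.some⟩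
  obtain ⟨f, hf⟩ := countable_iff_exists_subset_range.1 hT
  have hcover : ∀ x ∉ A, x ∈ ⋃ n, V (f n) := by
    intro x hx
    have : x ∈ ⋃ i ∈ T, V i := hTV ▸ mem_iUnion.2 ⟨x, hxV x hx⟩
    obtain ⟨i, hi, hxi⟩ := mem_iUnion₂.1 this
    obtain ⟨n, rfl⟩ := hf hi
    exact mem_iUnion.2 ⟨n, hxi⟩
  let r : X → A := fun x => if h : x ∈ A then ⟨x, h⟩ else c (f (firstIndex (fun n => V (f n)) x))
  have hr : ∀ a : A, r a = a := fun a => dif_pos a.2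
  have hdist : ∀ x : X, dist x (r x) ≤ 3 * Metric.infDist x A := by
    intro x
    by_cases hx : x ∈ A
    · rw [hr ⟨x, hx⟩, dist_self]
      exact mul_nonneg (by norm_num) Metric.infDist_nonneg
    · simp only [r, dif_neg hx]
      exact (hVc _ x (mem_firstIndex (hcover x hx))).le
  refine ⟨r, continuous_iff_continuousAt.2 fun x => ?_, hr⟩
  by_cases hx : x ∈ A
  · rw [ContinuousAt, tendsto_iff_dist_tendsto_zero]
    have hlim : Tendsto (fun y => 4 * dist y x) (𝓝 x) (𝓝 0) := by
      have : Continuous fun y => 4 * dist y x := by fun_prop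
      simpa using this.tendsto x
    refine squeeze_zero (fun _ => dist_nonneg) (fun y => ?_) hlim
    rw [hr ⟨x, hx⟩]
    have h₁ := hdist y
    have h₂ : Metric.infDist y A ≤ dist y x := Metric.infDist_le_dist_of_mem hx
    have h₃ : dist (r y : X) x ≤ dist y (r y) + dist y x := dist_triangle_left _ _ _
    change dist (r y : X) x ≤ _
    linarith
  · refine (continuousAt_const (y := r x)).congr ?_
    filter_upwards [hA.isOpen_compl.mem_nhds hx,
      eventually_firstIndex_eq (fun n => hV (f n)) (hcover x hx)] with y hy hy'
    simp only [r, dif_neg hx, dif_neg hy, hy'.2]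

/-- A strongly zero-dimensional σ-compact locally compact space carries a continuous `ℕ`-valued
function whose sublevel sets are contained in compact sets. -/
theorem StronglyZeroDimensional.exists_continuous_nat {X : Type*} [TopologicalSpace X]
    [T2Space X] [SigmaCompactSpace X] [LocallyCompactSpace X]
    (hX : StronglyZeroDimensional X) :
    ∃ l : X → ℕ, Continuous l ∧ ∀ n, IsCompact {x | l x ≤ n} := by
  let K := CompactExhaustion.choice X
  have key : ∀ n, ∃ V : Set X, IsClopen V ∧ K n ⊆ V ∧ V ⊆ K (n + 1) := by
    intro n
    obtain ⟨V, hV, h₁, h₂⟩ := hX (K n) (interior (K (n + 1)))ᶜ (K.isCompact n).isClosed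
      isOpen_interior.isClosed_compl
      (disjoint_compl_right_iff_subset.2 (K.subset_interior_succ n))
    exact ⟨V, hV, h₁, (disjoint_compl_right_iff_subset.1 h₂).trans interior_subset⟩
  choose V hV hKV hVK using key
  have hcover : ∀ x, x ∈ ⋃ n, V n := fun x =>
    mem_iUnion.2 ((K.exists_mem x).imp fun n hn => hKV n hn)
  have hcont : Continuous (firstIndex V) := continuous_iff_continuousAt.2 fun x =>
    continuousAt_const.congr ((eventually_firstIndex_eq hV (hcover x)).mono fun y hy => hy.2.symm)
  refine ⟨firstIndex V, hcont, fun n => (K.isCompact (n + 1)).of_isClosed_subset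
    (isClosed_le hcont continuous_const) fun x hx => ?_⟩
  exact K.subset (Nat.succ_le_succ hx) (hVK _ (mem_firstIndex (hcover x)))

/-- **Proper retracts.** A non-empty non-compact closed subset of a strongly
0-dimensional σ-compact locally compact metrizable space is a proper retract:
there is a continuous retraction `r : X → A` under which preimages of compact
sets are compact. -/
theorem proper_retract_of_closed
    {X : Type*} [TopologicalSpace X] [TopologicalSpace.MetrizableSpace X]
    [SigmaCompactSpace X] [LocallyCompactSpace X]
    (hX : StronglyZeroDimensional X)
    (A : Set X) (hA : IsClosed A) (hne : A.Nonempty) (hnc : ¬ IsCompact A) :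
    ∃ r : X → A, Continuous r ∧ (∀ a : A, r a = a) ∧
      ∀ K : Set A, IsCompact K → IsCompact (r ⁻¹' K) := by
  have : SecondCountableTopology X := by
    let _ := TopologicalSpace.metrizableSpaceMetric X
    exact EMetric.secondCountable_of_sigmaCompact X
  obtain ⟨s, hs, hsA⟩ := hX.exists_retraction hA hne
  obtain ⟨l, hl, hlc⟩ := hX.exists_continuous_nat
  have hunbdd : ∀ n, ∃ a : A, n ≤ l a := by
    intro n
    by_contra! h
    exact hnc ((hlc n).of_isClosed_subset hA fun a ha => (h ⟨a, ha⟩).le)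
  choose p hp using hunbdd
  let r : X → A := fun x => if l x ≤ l (s x) then s x else p (l x)
  have hclopen : IsClopen {x | l x ≤ l (s x)} :=
    (isClopen_discrete {q : ℕ × ℕ | q.1 ≤ q.2}).preimage
      (hl.prodMk (hl.comp (continuous_subtype_val.comp hs)))
  have hr : Continuous r := by
    refine continuous_if (fun x hx => ?_) hs.continuousOn
      ((continuous_of_discreteTopology.comp hl).continuousOn)
    rw [hclopen.frontier_eq] at hx
    exact hx.elim
  have hle : ∀ x, l x ≤ l (r x) := by
    intro x
    by_cases h : l x ≤ l (s x)
    · simpa only [r, if_pos h] using h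
    · simpa only [r, if_neg h] using hp (l x)
  refine ⟨r, hr, fun a => by simp [r, hsA], fun K hK => ?_⟩
  obtain ⟨N, hN⟩ := (hK.image (hl.comp continuous_subtype_val)).bddAbove
  exact (hlc N).of_isClosed_subset (hK.isClosed.preimage hr)
    fun x hx => (hle x).trans (hN (mem_image_of_mem _ hx))
end

section
/- Let S be an unbounded characteristic subset of [0, ∞), let X be a strongly 0-dimensional, σ-compact, locally compact metrizable topological space, and let A be a closed subset of X. For every proper ultrametric d on A taking values in S and generating the subspace topology of A, there exists a proper ultrametric D on X taking values in S and generating the topology of X such that the restriction of D to A × A equals d. -/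
/-- An ultrametric (given as a distance function) on a topological space that
generates its topology. -/
def IsUltrametricGen {X : Type*} [TopologicalSpace X] (d : X → X → ℝ) : Prop :=
  (∀ x y, 0 ≤ d x y) ∧
  (∀ x y, d x y = 0 ↔ x = y) ∧
  (∀ x y, d x y = d y x) ∧
  (∀ x y z, d x z ≤ max (d x y) (d y z)) ∧
  (∀ s : Set X, IsOpen s ↔ ∀ x ∈ s, ∃ ε > 0, ∀ y, d x y < ε → y ∈ s)

/-- `S` is a characteristic subset of `[0, ∞)`: it contains `0` and contains
arbitrarily small positive elements. -/
def IsCharacteristic (S : Set ℝ) : Prop :=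
  S ⊆ Set.Ici 0 ∧ (0 : ℝ) ∈ S ∧ ∀ r : ℝ, 0 < r → ∃ s ∈ S, s ≠ 0 ∧ s ≤ r

open Filter Topology

section UltrametricGen

variable {X : Type*} [TopologicalSpace X] {d : X → X → ℝ}

theorem IsUltrametricGen.of_nhds (h0 : ∀ x y, 0 ≤ d x y) (heq : ∀ x y, d x y = 0 ↔ x = y)
    (hsymm : ∀ x y, d x y = d y x) (htri : ∀ x y z, d x z ≤ max (d x y) (d y z))
    (hsmall : ∀ x, ∀ ε > 0, ∀ᶠ y in 𝓝 x, d x y < ε)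
    (hball : ∀ x, ∀ U ∈ 𝓝 x, ∃ ε > 0, ∀ y, d x y < ε → y ∈ U) : IsUltrametricGen d := by
  refine ⟨h0, heq, hsymm, htri, fun s => ⟨fun hs x hx => hball x s (hs.mem_nhds hx), fun h => ?_⟩⟩
  rw [isOpen_iff_mem_nhds]
  intro x hx
  obtain ⟨ε, hε, h⟩ := h x hx
  filter_upwards [hsmall x ε hε] with y hy using h y hy

theorem IsUltrametricGen.self_eq_zero (hd : IsUltrametricGen d) (x : X) : d x x = 0 :=
  (hd.2.1 x x).2 rfl

theorem IsUltrametricGen.triangle (hd : IsUltrametricGen d) (x y z : X) :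
    d x z ≤ max (d x y) (d y z) :=
  hd.2.2.2.1 x y z

theorem IsUltrametricGen.symm (hd : IsUltrametricGen d) (x y : X) : d x y = d y x :=
  hd.2.2.1 x y

theorem IsUltrametricGen.exists_ball_subset (hd : IsUltrametricGen d) {x : X} {U : Set X}
    (hU : U ∈ 𝓝 x) : ∃ ε > 0, ∀ y, d x y < ε → y ∈ U := by
  obtain ⟨V, hVU, hV, hx⟩ := mem_nhds_iff.1 hU
  obtain ⟨ε, hε, h⟩ := (hd.2.2.2.2 V).1 hV x hx
  exact ⟨ε, hε, fun y hy => hVU (h y hy)⟩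

theorem IsUltrametricGen.eventually_lt (hd : IsUltrametricGen d) (x : X) {ε : ℝ} (hε : 0 < ε) :
    ∀ᶠ y in 𝓝 x, d x y < ε := by
  have ho : IsOpen {y | d x y < ε} :=
    (hd.2.2.2.2 _).2 fun y hy =>
      ⟨ε, hε, fun z hz => (hd.triangle x y z).trans_lt (max_lt hy hz)⟩
  exact ho.mem_nhds (by simpa [hd.self_eq_zero x] using hε)

theorem IsUltrametricGen.continuous (hd : IsUltrametricGen d) (x : X) : Continuous (d x) := by
  rw [continuous_iff_continuousAt]
  intro y
  rw [ContinuousAt, Metric.tendsto_nhds]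
  intro ε hε
  filter_upwards [hd.eventually_lt y hε] with z hz
  have h1 := hd.triangle x y z
  have h2 := hd.triangle x z y
  have h3 := hd.symm y z
  have h4 := hd.1 x y
  have h5 := hd.1 x z
  have h6 := hd.1 y z
  rw [Real.dist_eq, abs_lt]
  grind

theorem IsProperMetric.isCompact_of_le (hp : IsProperMetric d) (hd : IsUltrametricGen d)
    {s : Set X} (hs : IsClosed s) {x : X} {C : ℝ} (h : ∀ y ∈ s, d x y ≤ C) : IsCompact s := by
  refine hp s hs ⟨C, fun y hy z hz => (hd.triangle y x z).trans (max_le ?_ (h z hz))⟩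
  rw [hd.symm]
  exact h y hy

/-- In a proper ultrametric space, every closed nonempty set contains nearest points. -/
theorem IsProperMetric.exists_nearest (hp : IsProperMetric d) (hd : IsUltrametricGen d)
    {A : Set X} (hA : IsClosed A) [Nonempty A] (x : X) :
    ∃ a : A, ∀ b : A, d x a ≤ d x b := by
  obtain ⟨a₀⟩ := ‹Nonempty A›
  have hcl : IsClosed (A ∩ {y | d x y ≤ d x a₀}) :=
    hA.inter (isClosed_le (hd.continuous x) continuous_const)
  obtain ⟨a, ha, hmin⟩ := (hp.isCompact_of_le hd hcl fun y hy => hy.2).exists_isMinOn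
    ⟨a₀, a₀.2, le_refl (d x a₀)⟩ (hd.continuous x).continuousOn
  refine ⟨⟨a, ha.1⟩, fun b => ?_⟩
  by_cases hb : d x b ≤ d x a₀
  · exact hmin ⟨b.2, hb⟩
  · exact ha.2.trans (not_le.1 hb).le

end UltrametricGen

section Existence

variable {X : Type*} [TopologicalSpace X]

theorem StronglyZeroDimensional.exists_separating_seq [T1Space X] [SecondCountableTopology X]
    (hX : StronglyZeroDimensional X) :
    ∃ U : ℕ → Set X, (∀ n, IsClopen (U n)) ∧
      ∀ x, ∀ W ∈ 𝓝 x, ∃ n, x ∈ U n ∧ U n ⊆ W := by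
  have hb : TopologicalSpace.IsTopologicalBasis {V : Set X | IsClopen V} := by
    refine TopologicalSpace.isTopologicalBasis_of_isOpen_of_nhds (fun V hV => hV.2) ?_
    intro x W hx hW
    obtain ⟨V, hV, h1, h2⟩ := hX {x} Wᶜ isClosed_singleton hW.isClosed_compl (by simpa using hx)
    exact ⟨V, hV, h1 rfl, Set.disjoint_compl_right_iff_subset.1 h2⟩
  obtain ⟨B, hBs, hBc, hB⟩ := hb.exists_countable
  obtain ⟨U, hU⟩ := (hBc.insert ∅).exists_eq_range (Set.insert_nonempty _ _)
  refine ⟨U, fun n => ?_, fun x W hW => ?_⟩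
  · have : U n ∈ insert ∅ B := hU ▸ Set.mem_range_self n
    rcases this with h | h
    · rw [h]; exact isClopen_empty
    · exact hBs h
  · obtain ⟨V, hV, hxV, hVW⟩ := hB.mem_nhds_iff.1 hW
    obtain ⟨n, rfl⟩ : V ∈ Set.range U := hU ▸ Set.mem_insert_of_mem _ hV
    exact ⟨n, hxV, hVW⟩

theorem IsClopen.eventually_mem_iff {U : Set X} (hU : IsClopen U) (x : X) :
    ∀ᶠ y in 𝓝 x, (y ∈ U ↔ x ∈ U) := by
  by_cases hx : x ∈ U
  · filter_upwards [hU.2.mem_nhds hx] with y hy using iff_of_true hy hx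
  · filter_upwards [hU.compl.2.mem_nhds hx] with y hy using iff_of_false hy hx

theorem IsCharacteristic.exists_seq {S : Set ℝ} (hS : IsCharacteristic S) :
    ∃ s : ℕ → ℝ, Antitone s ∧ (∀ n, 0 < s n) ∧ Tendsto s atTop (𝓝 0) ∧ ∀ n, s n ∈ S := by
  have hpos : ∀ r ∈ S \ {0}, 0 < r := fun r hr => lt_of_le_of_ne (hS.1 hr.1) (Ne.symm hr.2)
  have hglb : IsGLB (S \ {0}) 0 := by
    refine ⟨fun r hr => (hpos r hr).le, fun b hb => ?_⟩
    by_contra! h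
    obtain ⟨s, hs, h0, hsb⟩ := hS.2.2 (b / 2) (by linarith)
    have : b ≤ s := hb ⟨hs, h0⟩
    linarith
  obtain ⟨s₀, hs₀, h0, -⟩ := hS.2.2 1 one_pos
  obtain ⟨s, hanti, -, hlim, hmem⟩ := hglb.exists_seq_antitone_tendsto ⟨s₀, hs₀, h0⟩
  exact ⟨s, hanti, fun n => hpos _ (hmem n), hlim, fun n => (hmem n).1⟩

theorem StronglyZeroDimensional.exists_ultrametric [T1Space X] [SecondCountableTopology X]
    (hX : StronglyZeroDimensional X) {S : Set ℝ} (hS : IsCharacteristic S) :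
    ∃ τ : X → X → ℝ, IsUltrametricGen τ ∧ ∀ x y, τ x y ∈ S := by
  classical
  obtain ⟨U, hU, hbasis⟩ := hX.exists_separating_seq
  obtain ⟨s, hanti, hpos, hlim, hsS⟩ := hS.exists_seq
  let φ : X → ℕ → Prop := fun x n => x ∈ U n
  have hφ : ∀ x y, φ x = φ y → x = y := by
    intro x y h
    by_contra hne
    obtain ⟨n, hx, hn⟩ := hbasis x {y}ᶜ (isOpen_compl_singleton.mem_nhds hne)
    have hy : y ∈ U n := (congrFun h n).mp hx
    exact hn hy rfl
  let τ : X → X → ℝ := fun x y => if x = y then 0 else s (PiNat.firstDiff (φ x) (φ y))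
  have hself : ∀ x, τ x x = 0 := fun x => if_pos rfl
  have hne : ∀ {x y}, x ≠ y → τ x y = s (PiNat.firstDiff (φ x) (φ y)) := fun h => if_neg h
  have h0 : ∀ x y, 0 ≤ τ x y := by
    intro x y
    by_cases h : x = y
    · rw [h, hself]
    · rw [hne h]; exact (hpos _).le
  refine ⟨τ, IsUltrametricGen.of_nhds h0 ?_ ?_ ?_ ?_ ?_, ?_⟩
  · intro x y
    refine ⟨fun h => ?_, fun h => h ▸ hself x⟩
    by_contra hxy
    rw [hne hxy] at h
    exact (hpos _).ne' h
  · intro x y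
    by_cases h : x = y
    · rw [h]
    · rw [hne h, hne (Ne.symm h), PiNat.firstDiff_comm]
  · intro x y z
    by_cases hxz : x = z
    · subst hxz
      rw [hself]
      exact le_max_of_le_left (h0 _ _)
    by_cases hxy : x = y
    · subst hxy; exact le_max_right _ _
    by_cases hyz : y = z
    · subst hyz; exact le_max_left _ _
    rw [hne hxz, hne hxy, hne hyz, ← hanti.map_min]
    exact hanti (PiNat.min_firstDiff_le _ _ _ fun h => hxz (hφ _ _ h))
  · intro x ε hε
    obtain ⟨N, hN⟩ := (hlim.eventually (gt_mem_nhds hε)).exists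
    have hev : ∀ᶠ y in 𝓝 x, ∀ n ∈ Finset.range N, (y ∈ U n ↔ x ∈ U n) :=
      (Finset.eventually_all _).2 fun n _ => (hU n).eventually_mem_iff x
    filter_upwards [hev] with y hy
    by_cases hxy : x = y
    · rw [hxy, hself]; exact hε
    rw [hne hxy]
    refine (hanti ?_).trans_lt hN
    by_contra! hlt
    exact PiNat.apply_firstDiff_ne (fun h => hxy (hφ _ _ h))
      (propext (hy _ (Finset.mem_range.2 hlt)).symm)
  · intro x W hW
    obtain ⟨n, hx, hn⟩ := hbasis x W hW
    refine ⟨s n, hpos n, fun y hy => ?_⟩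
    by_cases hxy : x = y
    · exact hxy ▸ mem_of_mem_nhds hW
    rw [hne hxy] at hy
    have hlt : n < PiNat.firstDiff (φ x) (φ y) := hanti.reflect_lt hy
    exact hn ((PiNat.apply_eq_of_lt_firstDiff hlt).mp hx)
  · intro x y
    by_cases h : x = y
    · rw [h, hself]; exact hS.2.1
    · rw [hne h]; exact hsS _

theorem StronglyZeroDimensional.exists_exhausting_function [T2Space X] [SigmaCompactSpace X]
    [LocallyCompactSpace X] (hX : StronglyZeroDimensional X) :
    ∃ g : X → ℕ, (∀ x, ∀ᶠ y in 𝓝 x, g y = g x) ∧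
      ∀ N, ∃ K : Set X, IsCompact K ∧ ∀ y, g y ≤ N → y ∈ K := by
  classical
  let K := CompactExhaustion.choice X
  have hV : ∀ n, ∃ V, IsClopen V ∧ K n ⊆ V ∧ V ⊆ K (n + 1) := by
    intro n
    obtain ⟨V, hV, h1, h2⟩ := hX (K n) (interior (K (n + 1)))ᶜ (K.isCompact n).isClosed
      isOpen_interior.isClosed_compl
      (Set.disjoint_compl_right_iff_subset.2 (K.subset_interior_succ n))
    exact ⟨V, hV, h1, (Set.disjoint_compl_right_iff_subset.1 h2).trans interior_subset⟩
  choose V hV hKV hVK using hV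
  have hex : ∀ x, ∃ n, x ∈ V n := fun x => (K.exists_mem x).imp fun n hn => hKV n hn
  refine ⟨fun x => Nat.find (hex x), fun x => ?_, fun N => ⟨K (N + 1), K.isCompact _, ?_⟩⟩
  · have hev : ∀ᶠ y in 𝓝 x, ∀ n ∈ Finset.range (Nat.find (hex x) + 1), (y ∈ V n ↔ x ∈ V n) :=
      (Finset.eventually_all _).2 fun n _ => (hV n).eventually_mem_iff x
    filter_upwards [hev] with y hy
    rw [Nat.find_eq_iff]
    refine ⟨(hy _ (by simp)).2 (Nat.find_spec (hex x)), fun n hn hyn => ?_⟩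
    exact Nat.find_min (hex x) hn ((hy n (Finset.mem_range.2 (Nat.lt_succ_of_lt hn))).1 hyn)
  · intro y hy
    exact K.subset (Nat.add_le_add_right hy 1) (hVK _ (Nat.find_spec (hex y)))

theorem StronglyZeroDimensional.exists_proper_ultrametric [T2Space X]
    [SecondCountableTopology X] [SigmaCompactSpace X] [LocallyCompactSpace X]
    (hX : StronglyZeroDimensional X) {S : Set ℝ} (hS : IsCharacteristic S)
    (hSu : ¬ BddAbove S) :
    ∃ σ : X → X → ℝ, IsUltrametricGen σ ∧ (∀ x y, σ x y ∈ S) ∧ IsProperMetric σ := by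
  classical
  obtain ⟨τ, hτ, hτS⟩ := hX.exists_ultrametric hS
  obtain ⟨g, hg, hgK⟩ := hX.exists_exhausting_function
  have ht : ∀ n : ℕ, ∃ t ∈ S, (n : ℝ) < t := fun n => not_bddAbove_iff.1 hSu n
  choose t htS htn using ht
  let e : X → X → ℝ := fun x y => if g x = g y then 0 else max (t (g x)) (t (g y))
  have ht0 : ∀ n, 0 < t n := fun n => (Nat.cast_nonneg n).trans_lt (htn n)
  have he0 : ∀ x y, 0 ≤ e x y := by
    intro x y
    simp only [e]
    split_ifs
    exacts [le_rfl, le_max_of_le_left (ht0 _).le]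
  have hmaxS : ∀ {a b : ℝ}, a ∈ S → b ∈ S → max a b ∈ S := fun ha hb => max_rec' (· ∈ S) ha hb
  refine ⟨fun x y => max (τ x y) (e x y), IsUltrametricGen.of_nhds ?_ ?_ ?_ ?_ ?_ ?_, ?_, ?_⟩
  · exact fun x y => le_max_of_le_left (hτ.1 x y)
  · intro x y
    refine ⟨fun h => (hτ.2.1 x y).1 (le_antisymm (h ▸ le_max_left _ _) (hτ.1 x y)), ?_⟩
    rintro rfl
    simp [e, hτ.self_eq_zero]
  · intro x y
    simp only [e, hτ.symm x y, eq_comm (a := g x), max_comm (t (g x))]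
  · intro x y z
    have h : e x z ≤ max (e x y) (e y z) := by
      by_cases hxz : g x = g z
      · simp only [e, if_pos hxz]
        exact le_max_of_le_left (he0 x y)
      by_cases hxy : g x = g y
      · refine le_max_of_le_right (le_of_eq ?_)
        simp only [e, hxy]
      by_cases hyz : g y = g z
      · refine le_max_of_le_left (le_of_eq ?_)
        simp only [e, hyz]
      simp only [e, if_neg hxz, if_neg hxy, if_neg hyz]
      exact max_le_max (le_max_left _ _) (le_max_right _ _)
    exact max_le ((hτ.triangle x y z).trans (max_le_max (le_max_left _ _) (le_max_left _ _)))
      (h.trans (max_le_max (le_max_right _ _) (le_max_right _ _)))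
  · intro x ε hε
    filter_upwards [hτ.eventually_lt x hε, hg x] with y hy hgy
    simp [e, hgy, hy, hε]
  · intro x W hW
    obtain ⟨ε, hε, h⟩ := hτ.exists_ball_subset hW
    exact ⟨ε, hε, fun y hy => h y ((le_max_left _ _).trans_lt hy)⟩
  · intro x y
    refine hmaxS (hτS x y) ?_
    simp only [e]
    split_ifs
    exacts [hS.2.1, hmaxS (htS _) (htS _)]
  · rintro T hT ⟨C, hC⟩
    rcases T.eq_empty_or_nonempty with rfl | ⟨x, hx⟩
    · exact isCompact_empty
    obtain ⟨K, hK, hgK⟩ := hgK (max (g x) ⌈C⌉₊)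
    refine hK.of_isClosed_subset hT fun y hy => hgK y ?_
    by_cases hxy : g x = g y
    · exact hxy ▸ le_max_left _ _
    · have h : e x y ≤ C := (le_max_right _ _).trans (hC x hx y hy)
      simp only [e, if_neg hxy] at h
      have h' : (g y : ℝ) ≤ C := (htn _).le.trans ((le_max_right _ _).trans h)
      exact le_max_of_le_right (Nat.cast_le.1 (h'.trans (Nat.le_ceil C)))

end Existence

section Extension

variable {X : Type*} [TopologicalSpace X] {σ : X → X → ℝ} {A : Set X}

/-- A nearest-point retraction which is constant on every ball disjoint from `A`. -/
theorem IsProperMetric.exists_nearest_retraction (hp : IsProperMetric σ)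
    (hσ : IsUltrametricGen σ) (hA : IsClosed A) [Nonempty A] :
    ∃ r : X → A, (∀ x, ∀ b : A, σ x (r x) ≤ σ x b) ∧ (∀ a : A, r a = a) ∧
      ∀ x y, σ x y < σ x (r x) → r x = r y := by
  let P : X → A → Prop := fun x a => ∀ b : A, σ x a ≤ σ x b
  let r : X → A := fun x => Classical.epsilon (P x)
  have hr : ∀ x, P x (r x) := fun x => Classical.epsilon_spec (hp.exists_nearest hσ hA x)
  refine ⟨r, hr, fun a => ?_, fun x y hxy => ?_⟩
  · have h := hr a a
    rw [hσ.self_eq_zero] at h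
    exact Subtype.ext ((hσ.2.1 _ _).1 (le_antisymm h (hσ.1 _ _))).symm
  · have heq : ∀ a : A, σ x a = σ y a := by
      intro a
      have h1 := hxy.trans_le (hr x a)
      have h2 := hσ.triangle x y a
      have h3 := hσ.triangle y x a
      have h4 := hσ.symm x y
      grind
    have hP : P x = P y := by
      funext a
      simp only [P, heq]
    simp only [r, hP]

/-- A proper ultrametric on a closed subset extends to the whole space, as soon as the whole
space carries some proper ultrametric. -/
theorem IsProperMetric.exists_extension (hp : IsProperMetric σ) (hσ : IsUltrametricGen σ)
    (hA : IsClosed A) [Nonempty A] {S : Set ℝ} (hσS : ∀ x y, σ x y ∈ S)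
    {d : A → A → ℝ} (hd : IsUltrametricGen d) (hdS : ∀ a b : A, d a b ∈ S)
    (hdp : IsProperMetric d) :
    ∃ D : X → X → ℝ, IsUltrametricGen D ∧ (∀ x y, D x y ∈ S) ∧
      IsProperMetric D ∧ ∀ a b : A, D a b = d a b := by
  obtain ⟨r, hr, hrA, hrconst⟩ := hp.exists_nearest_retraction hσ hA
  let ρ : X → ℝ := fun x => σ x (r x)
  have hρ0 : ∀ x, 0 ≤ ρ x := fun x => hσ.1 _ _
  have hρA : ∀ a : A, ρ a = 0 := fun a => by simp only [ρ, hrA, hσ.self_eq_zero]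
  have hρ_eq : ∀ x, ρ x = 0 → x = r x := fun x h => (hσ.2.1 _ _).1 h
  have hρ_le : ∀ x y, ρ x ≤ max (σ x y) (ρ y) := fun x y =>
    (hr x (r y)).trans (hσ.triangle _ _ _)
  let e : X → X → ℝ := fun x y => min (σ x y) (max (ρ x) (ρ y))
  have he0 : ∀ x y, 0 ≤ e x y := fun x y => le_min (hσ.1 _ _) (le_max_of_le_left (hρ0 x))
  have hmaxS : ∀ {a b : ℝ}, a ∈ S → b ∈ S → max a b ∈ S := fun ha hb => max_rec' (· ∈ S) ha hb
  have hminS : ∀ {a b : ℝ}, a ∈ S → b ∈ S → min a b ∈ S := fun ha hb => min_rec' (· ∈ S) ha hb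
  refine ⟨fun x y => max (d (r x) (r y)) (e x y),
    IsUltrametricGen.of_nhds ?_ ?_ ?_ ?_ ?_ ?_, ?_, ?_, ?_⟩
  · exact fun x y => le_max_of_le_left (hd.1 _ _)
  · intro x y
    constructor
    · intro h
      have hdr : d (r x) (r y) = 0 := le_antisymm (h ▸ le_max_left _ _) (hd.1 _ _)
      have he : e x y = 0 := le_antisymm (h ▸ le_max_right _ _) (he0 x y)
      rcases min_choice (σ x y) (max (ρ x) (ρ y)) with h' | h'
      · exact (hσ.2.1 x y).1 (h'.symm.trans he)
      · have hmax : max (ρ x) (ρ y) = 0 := h'.symm.trans he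
        have hx : ρ x = 0 := le_antisymm (hmax ▸ le_max_left _ _) (hρ0 x)
        have hy : ρ y = 0 := le_antisymm (hmax ▸ le_max_right _ _) (hρ0 y)
        rw [hρ_eq x hx, hρ_eq y hy, (hd.2.1 _ _).1 hdr]
    · rintro rfl
      simp [e, hσ.self_eq_zero, hd.self_eq_zero, hρ0]
  · intro x y
    simp only [e, hd.symm (r x), hσ.symm x, max_comm (ρ x)]
  · intro x y z
    have h1 := hσ.triangle x y z
    have h2 := hd.triangle (r x) (r y) (r z)
    have h3 := hρ_le x y
    have h4 := hρ_le z y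
    rw [hσ.symm z y] at h4
    have h : e x z ≤ max (e x y) (e y z) := by
      simp only [e]
      grind
    exact max_le (h2.trans (max_le_max (le_max_left _ _) (le_max_left _ _)))
      (h.trans (max_le_max (le_max_right _ _) (le_max_right _ _)))
  · intro x ε hε
    rcases (hρ0 x).eq_or_lt with hx | hx
    · have hxr := hρ_eq x hx.symm
      have hU := hd.eventually_lt (r x) hε
      rw [nhds_subtype, eventually_comap] at hU
      obtain ⟨δ, hδ, hδU⟩ := hσ.exists_ball_subset hU
      filter_upwards [hσ.eventually_lt x hε, hσ.eventually_lt x hδ] with y hy hyδ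
      refine max_lt (hδU (r y) ?_ (r y) rfl) ((min_le_left _ _).trans_lt hy)
      rw [← hxr]
      refine (hσ.triangle x y (r y)).trans_lt (max_lt hyδ ((hr y (r x)).trans_lt ?_))
      rwa [← hxr, hσ.symm]
    · filter_upwards [hσ.eventually_lt x hε, hσ.eventually_lt x hx] with y hy hyρ
      rw [← hrconst x y hyρ, hd.self_eq_zero]
      exact max_lt hε ((min_le_left _ _).trans_lt hy)
  · intro x W hW
    obtain ⟨δ, hδ, hδW⟩ := hσ.exists_ball_subset hW
    rcases (hρ0 x).eq_or_lt with hx | hx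
    · have hxr := hρ_eq x hx.symm
      have hU : ∀ᶠ b : A in 𝓝 (r x), σ (r x) b < δ :=
        continuous_subtype_val.continuousAt.eventually (hσ.eventually_lt (r x : X) hδ)
      obtain ⟨η, hη, hηU⟩ := hd.exists_ball_subset hU
      refine ⟨min δ η, lt_min hδ hη, fun y hy => hδW y ?_⟩
      obtain ⟨h1, h2⟩ := max_lt_iff.1 hy
      have h3 : σ (r x) (r y) < δ := hηU _ (h1.trans_le (min_le_right _ _))
      rw [← hxr] at h3
      rcases min_lt_iff.1 (h2.trans_le (min_le_left _ _)) with h | h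
      · exact h
      · refine (hσ.triangle x (r y) y).trans_lt (max_lt h3 ?_)
        rw [hσ.symm]
        exact (le_max_right _ _).trans_lt h
    · refine ⟨min δ (ρ x), lt_min hδ hx, fun y hy => hδW y ?_⟩
      have h := (le_max_right _ _).trans_lt hy
      rcases min_lt_iff.1 h with h | h
      · exact h.trans_le (min_le_left _ _)
      · exact absurd ((le_max_left _ _).trans_lt h) (not_lt.2 (min_le_right _ _))
  · exact fun x y => hmaxS (hdS _ _) (hminS (hσS _ _) (hmaxS (hσS _ _) (hσS _ _)))
  · rintro T hT ⟨C, hC⟩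
    rcases T.eq_empty_or_nonempty with rfl | ⟨x, hx⟩
    · exact isCompact_empty
    have hB : IsCompact {b : A | d (r x) b ≤ C} :=
      hdp.isCompact_of_le hd (isClosed_le (hd.continuous (r x)) continuous_const) fun _ hy => hy
    obtain ⟨M, hM⟩ := hB.bddAbove_image
      ((hσ.continuous x).comp continuous_subtype_val).continuousOn
    refine hp.isCompact_of_le hσ hT (x := x) (C := max M C) fun y hy => ?_
    obtain ⟨h1, h2⟩ := max_le_iff.1 (hC x hx y hy)
    rcases min_le_iff.1 h2 with h | h
    · exact le_max_of_le_right h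
    · refine (hσ.triangle x (r y) y).trans (max_le_max (hM ⟨r y, h1, rfl⟩) ?_)
      rw [hσ.symm]
      exact (le_max_right _ _).trans h
  · intro a b
    simp [e, hrA, hρA, hσ.1, hd.1]

end Extension

/-- **Extension of proper ultrametrics.** Let `S` be an unbounded characteristic
subset of `[0, ∞)`, `X` a strongly 0-dimensional σ-compact locally compact
metrizable space, and `A` a closed subset. Every proper `S`-valued ultrametric
`d` on `A` generating the subspace topology extends to a proper `S`-valued
ultrametric `D` on `X` generating the topology of `X`. -/
theorem extend_proper_ultrametric
    {X : Type*} [TopologicalSpace X] [TopologicalSpace.MetrizableSpace X]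
    [SigmaCompactSpace X] [LocallyCompactSpace X]
    (hX : StronglyZeroDimensional X)
    (S : Set ℝ) (hS : IsCharacteristic S) (hSu : ¬ BddAbove S)
    (A : Set X) (hA : IsClosed A)
    (d : A → A → ℝ) (hd : IsUltrametricGen d) (hdS : ∀ a b : A, d a b ∈ S)
    (hdp : IsProperMetric d) :
    ∃ D : X → X → ℝ, IsUltrametricGen D ∧ (∀ x y, D x y ∈ S) ∧
      IsProperMetric D ∧ ∀ a b : A, D a b = d a b := by
  let _ := TopologicalSpace.metrizableSpaceMetric X
  obtain ⟨σ, hσ, hσS, hp⟩ := hX.exists_proper_ultrametric hS hSu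
  rcases isEmpty_or_nonempty A with hE | hN
  · exact ⟨σ, hσ, hσS, hp, fun a => hE.elim a⟩
  · exact hp.exists_extension hσ hA hσS hd hdS hdp
end

section
/- Let X be a normal topological space, let A be a closed subset of X, and let Z be a closed Gδ subset of X. Let f : A → [0, 1] be a continuous function such that Z ∩ A = f⁻¹({0}). Then there exists a continuous function F : X → [0, 1] such that F restricted to A equals f and F⁻¹({0}) = Z. -/
/-- In a normal space, a closed set and a disjoint countable union of closed sets are separated by
a nonnegative continuous function vanishing on the former and positive on the latter. -/
theorem exists_continuous_eqOn_zero_pos_of_iUnion_isClosed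
    {X : Type*} [TopologicalSpace X] [NormalSpace X] {s : Set X} {t : ℕ → Set X}
    (hs : IsClosed s) (ht : ∀ n, IsClosed (t n)) (hst : ∀ n, Disjoint s (t n)) :
    ∃ h : C(X, ℝ), Set.EqOn h 0 s ∧ (∀ x, 0 ≤ h x) ∧ ∀ n, ∀ x ∈ t n, 0 < h x := by
  choose g hgs hgt hg using fun n => exists_continuous_zero_one_of_isClosed hs (ht n) (hst n)
  have hbound (n : ℕ) (x : X) : ‖g n x * (1 / 2 / 2 ^ n)‖ ≤ 1 / 2 / 2 ^ n := by
    simp [abs_of_nonneg (hg n x).1, (hg n x).2]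
  have hnonneg (n : ℕ) (x : X) : 0 ≤ g n x * (1 / 2 / 2 ^ n) :=
    mul_nonneg (hg n x).1 (by positivity)
  have hsum (x : X) : Summable fun n => g n x * (1 / 2 / 2 ^ n) :=
    (summable_geometric_two' 1).of_norm_bounded fun n => hbound n x
  refine ⟨⟨fun x => ∑' n, g n x * (1 / 2 / 2 ^ n),
    continuous_tsum (fun n => by fun_prop) (summable_geometric_two' 1) hbound⟩,
    fun x hx => ?_, fun x => tsum_nonneg fun n => hnonneg n x, fun n x hx => ?_⟩
  · have hzero (n : ℕ) : g n x = 0 := hgs n hx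
    simp [hzero]
  · refine (hsum x).tsum_pos (fun m => hnonneg m x) n ?_
    have hone : g n x = 1 := hgt n hx
    rw [hone]
    positivity

/-- A continuous function on a closed set `A` with values in `t ∋ c`, equal to `c` on `A ∩ Z` with
`Z` closed, extends to a continuous function with values in `t` that equals `c` on `Z`. -/
theorem exists_continuous_extension_eqOn_const
    {X : Type*} [TopologicalSpace X] [NormalSpace X] {A Z : Set X}
    (hA : IsClosed A) (hZ : IsClosed Z) {t : Set ℝ} [t.OrdConnected] {c : ℝ} (hc : c ∈ t)
    {f : A → ℝ} (hf : Continuous f) (hft : ∀ a, f a ∈ t) (hfZ : ∀ a : A, (a : X) ∈ Z → f a = c) :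
    ∃ G : C(X, ℝ), (∀ x, G x ∈ t) ∧ (∀ a : A, G a = f a) ∧ ∀ x ∈ Z, G x = c := by
  classical
  let k : X → ℝ := fun x => if hx : x ∈ A then f ⟨x, hx⟩ else c
  have hkA (a : A) : k a = f a := dif_pos a.2
  have hkZ (x : X) (hx : x ∈ Z) : k x = c := by
    by_cases hxA : x ∈ A
    · exact (hkA ⟨x, hxA⟩).trans (hfZ _ hx)
    · exact dif_neg hxA
  have hkt (x : X) : k x ∈ t := by
    by_cases hxA : x ∈ A
    · simpa [k, hxA] using hft ⟨x, hxA⟩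
    · simpa [k, hxA] using hc
  have hkcA : ContinuousOn k A := by
    rw [continuousOn_iff_continuous_domRestrict]
    exact hf.congr fun a => (hkA a).symm
  have hkc : ContinuousOn k (A ∪ Z) :=
    hkcA.union_of_isClosed (continuousOn_const.congr hkZ) hA hZ
  obtain ⟨G, hGt, hG⟩ := ContinuousMap.exists_restrict_eq_forall_mem_of_closed
    ⟨_, hkc.domRestrict⟩ (fun x => hkt x) ⟨c, hc⟩ (hA.union hZ)
  have hGk (x : X) (hx : x ∈ A ∪ Z) : G x = k x := DFunLike.congr_fun hG ⟨x, hx⟩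
  exact ⟨G, hGt, fun a => (hGk a (.inl a.2)).trans (hkA a),
    fun x hx => (hGk x (.inr hx)).trans (hkZ x hx)⟩

/-- **Controlled Tietze–Urysohn extension.** Let `X` be a normal space, `A` a
closed subset, and `Z` a closed Gδ subset of `X`. If `f : A → [0, 1]` is
continuous with `Z ∩ A = f⁻¹(0)`, then there is a continuous `F : X → [0, 1]`
with `F|_A = f` and `F⁻¹(0) = Z`. -/
theorem tietze_urysohn_with_zero_set
    {X : Type*} [TopologicalSpace X] [NormalSpace X]
    (A : Set X) (hA : IsClosed A)
    (Z : Set X) (hZc : IsClosed Z) (hZG : IsGδ Z)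
    (f : A → ℝ) (hfc : Continuous f) (hf01 : ∀ a, f a ∈ Set.Icc (0 : ℝ) 1)
    (hfz : ∀ a : A, f a = 0 ↔ (a : X) ∈ Z) :
    ∃ F : X → ℝ, Continuous F ∧ (∀ x, F x ∈ Set.Icc (0 : ℝ) 1) ∧
      (∀ a : A, F a = f a) ∧ (∀ x : X, F x = 0 ↔ x ∈ Z) := by
  obtain ⟨G, hG, hGA, hGZ⟩ := exists_continuous_extension_eqOn_const hA hZc
    (Set.left_mem_Icc.2 zero_le_one) hfc hf01 fun a => (hfz a).2
  obtain ⟨U, hU, hZU⟩ := hZG.eq_iInter_nat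
  have hdisj (n : ℕ) : Disjoint (A ∪ Z) (G ⁻¹' {0} ∩ (U n)ᶜ) := by
    have hZUn : Z ⊆ U n := hZU ▸ Set.iInter_subset U n
    refine Set.disjoint_left.2 fun x hx hxn => hxn.2 (hZUn ?_)
    rcases hx with hx | hx
    · exact (hfz ⟨x, hx⟩).1 ((hGA ⟨x, hx⟩).symm.trans hxn.1)
    · exact hx
  obtain ⟨h, hzero, hnonneg, hpos⟩ := exists_continuous_eqOn_zero_pos_of_iUnion_isClosed
    (hA.union hZc)
    (fun n => (isClosed_singleton.preimage G.continuous).inter (hU n).isClosed_compl) hdisj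
  have hh (x : X) (hx : x ∈ A ∪ Z) : h x = 0 := hzero hx
  refine ⟨fun x => min 1 (G x + h x), by fun_prop, fun x =>
    ⟨le_min zero_le_one (add_nonneg (hG x).1 (hnonneg x)), min_le_left _ _⟩, fun a => ?_,
    fun x => ⟨fun hx => ?_, fun hx => ?_⟩⟩
  · simp [hh a (.inl a.2), hGA, (hf01 a).2]
  · have hsum : G x + h x = 0 := by
      rcases min_choice 1 (G x + h x) with hm | hm <;> linarith
    have hGx : G x = 0 := by linarith [(hG x).1, hnonneg x]
    rw [hZU, Set.mem_iInter]
    intro n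
    by_contra hxn
    linarith [hpos n x ⟨hGx, hxn⟩]
  · simp [hh x (.inr hx), hGZ x hx]
end

section
/- Let S be an unbounded subset of [0, ∞) and let X be a strongly 0-dimensional, σ-compact, locally compact Hausdorff topological space. Then there exists a continuous proper function f : X → S (where S carries the subspace topology of ℝ and proper means preimages of compact sets are compact). -/
/-- A strongly 0-dimensional, σ-compact, locally compact space has an increasing exhaustion by
compact clopen sets. -/
theorem StronglyZeroDimensional.exists_isClopen_exhaustion
    {X : Type*} [TopologicalSpace X] [T2Space X] [SigmaCompactSpace X] [LocallyCompactSpace X]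
    (hX : StronglyZeroDimensional X) :
    ∃ V : ℕ → Set X, (∀ n, IsClopen (V n)) ∧ (∀ n, IsCompact (V n)) ∧ Monotone V ∧
      ∀ x, ∃ n, x ∈ V n := by
  let K : CompactExhaustion X := CompactExhaustion.choice X
  have hsep : ∀ n, ∃ V : Set X, IsClopen V ∧ K n ⊆ V ∧ Disjoint V (interior (K (n + 1)))ᶜ :=
    fun n => hX _ _ (K.isCompact n).isClosed isOpen_interior.isClosed_compl
      (Set.disjoint_compl_right_iff_subset.2 (K.subset_interior_succ n))
  choose V hVc hKV hdisj using hsep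
  have hVK : ∀ n, V n ⊆ K (n + 1) := fun n =>
    (Set.disjoint_compl_right_iff_subset.1 (hdisj n)).trans interior_subset
  refine ⟨V, hVc, fun n => (K.isCompact (n + 1)).of_isClosed_subset (hVc n).isClosed (hVK n),
    monotone_nat_of_le_succ fun n => (hVK n).trans (hKV (n + 1)), fun x => ?_⟩
  obtain ⟨n, hn⟩ := K.exists_mem x
  exact ⟨n, hKV n hn⟩

/-- A strongly 0-dimensional, σ-compact, locally compact space admits a continuous function to `ℕ`
with compact sublevel sets. -/
theorem StronglyZeroDimensional.exists_continuous_nat_isCompact_le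
    {X : Type*} [TopologicalSpace X] [T2Space X] [SigmaCompactSpace X] [LocallyCompactSpace X]
    (hX : StronglyZeroDimensional X) :
    ∃ N : X → ℕ, Continuous N ∧ ∀ n, IsCompact {x | N x ≤ n} := by
  classical
  obtain ⟨V, hVc, hVK, hmono, hV⟩ := hX.exists_isClopen_exhaustion
  have hle : ∀ n, {x | Nat.find (hV x) ≤ n} = V n := fun n => by
    ext x
    exact ⟨fun h => hmono h (Nat.find_spec (hV x)), fun h => Nat.find_min' (hV x) h⟩
  refine ⟨fun x => Nat.find (hV x), continuous_discrete_rng.2 fun n => ?_,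
    fun n => (hle n).symm ▸ hVK n⟩
  have hpre : (fun x => Nat.find (hV x)) ⁻¹' {n} = V n \ ⋃ m ∈ Set.Iio n, V m := by
    ext x
    simp [Nat.find_eq_iff]
  rw [hpre]
  exact (hVc n).isOpen.sdiff
    ((Set.finite_Iio n).isClosed_biUnion fun m _ => (hVc m).isClosed)

/-- **Proper functions into an unbounded set.** Let `S` be an unbounded subset of
`[0, ∞)` and `X` a strongly 0-dimensional σ-compact locally compact Hausdorff
space. Then there exists a continuous proper function `f : X → S`, where `S`
carries the subspace topology of `ℝ`. -/
theorem exists_proper_function_into_unbounded_set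
    {X : Type*} [TopologicalSpace X] [T2Space X]
    [SigmaCompactSpace X] [LocallyCompactSpace X]
    (hX : StronglyZeroDimensional X)
    (S : Set ℝ) (hS : S ⊆ Set.Ici 0) (hSu : ¬ BddAbove S) :
    ∃ f : X → S, Continuous f ∧
      ∀ K : Set S, IsCompact K → IsCompact (f ⁻¹' K) := by
  obtain ⟨N, hN, hNK⟩ := hX.exists_continuous_nat_isCompact_le
  have hlarge : ∀ n : ℕ, ∃ s : S, (n : ℝ) < s := fun n => by
    obtain ⟨s, hs, hns⟩ := not_bddAbove_iff.1 hSu n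
    exact ⟨⟨s, hs⟩, hns⟩
  choose s hs using hlarge
  have hf : Continuous (s ∘ N) := continuous_of_discreteTopology.comp hN
  refine ⟨s ∘ N, hf, fun K hK => ?_⟩
  obtain ⟨B, hB⟩ := (hK.image continuous_subtype_val).bddAbove
  obtain ⟨n, hn⟩ := exists_nat_ge B
  refine (hNK n).of_isClosed_subset (hK.isClosed.preimage hf) fun x hx => ?_
  have hxB : (s (N x) : ℝ) ≤ B := hB (Set.mem_image_of_mem _ hx)
  exact_mod_cast ((hs (N x)).le.trans hxB).trans hn
end

section
/- Let S be a sporadic subset of [0, ∞), and let M_S be the ultrametric on S defined by M_S(x, y) = 0 if x = y and M_S(x, y) = max(x, y) if x ≠ y. Then the topology on S induced by M_S coincides with the Euclidean (subspace) topology on S. -/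
/-- `S ⊆ [0, ∞)` is sporadic: `S = {0} ∪ {s_n : n ∈ ℤ}` for a strictly increasing
sequence `(s_n)_{n ∈ ℤ}` with `s_n → 0` as `n → −∞` and `s_n → ∞` as `n → ∞`. -/
def Sporadic (S : Set ℝ) : Prop :=
  ∃ s : ℤ → ℝ, StrictMono s ∧ S = insert 0 (Set.range s) ∧
    Filter.Tendsto s Filter.atBot (nhds 0) ∧
    Filter.Tendsto s Filter.atTop Filter.atTop

theorem StrictMono.pos_of_tendsto_atBot_zero {s : ℤ → ℝ} (hs : StrictMono s)
    (h0 : Filter.Tendsto s Filter.atBot (nhds 0)) (n : ℤ) : 0 < s n :=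
  (hs.monotone.le_of_tendsto h0 (n - 1)).trans_lt (hs (by lia))

theorem Sporadic.nonneg {S : Set ℝ} (hS : Sporadic S) {x : ℝ} (hx : x ∈ S) : 0 ≤ x := by
  obtain ⟨s, hs, rfl, h0, -⟩ := hS
  rcases hx with rfl | ⟨n, rfl⟩
  · exact le_rfl
  · exact (hs.pos_of_tendsto_atBot_zero h0 n).le

/-- Every nonzero point of a sporadic set is isolated. -/
theorem Sporadic.exists_forall_dist_lt_eq {S : Set ℝ} (hS : Sporadic S) {x : ℝ} (hx : x ∈ S)
    (hx0 : x ≠ 0) : ∃ δ > 0, ∀ y ∈ S, dist y x < δ → y = x := by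
  obtain ⟨s, hs, rfl, h0, -⟩ := hS
  rcases hx with rfl | ⟨n, rfl⟩
  · exact absurd rfl hx0
  have hl : s (n - 1) < s n := hs (by lia)
  have hr : s n < s (n + 1) := hs (by lia)
  refine ⟨min (s n - s (n - 1)) (s (n + 1) - s n), lt_min (by linarith) (by linarith), ?_⟩
  intro y hy hd
  rw [Real.dist_eq, lt_min_iff, abs_lt, abs_lt] at hd
  rcases hy with rfl | ⟨m, rfl⟩
  · linarith [hs.pos_of_tendsto_atBot_zero h0 (n - 1), hd.1.1]
  · have h1 : n - 1 < m := hs.lt_iff_lt.mp (by linarith [hd.1.1])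
    have h2 : m < n + 1 := hs.lt_iff_lt.mp (by linarith [hd.2.2])
    rw [show m = n by lia]

/-- **Topology induced by `M_S` on a sporadic set.** Let `S` be a sporadic subset
of `[0, ∞)` and let `M_S(x, y) = 0` if `x = y`, `max x y` otherwise. Then the
topology on `S` induced by the ultrametric `M_S` coincides with the Euclidean
(subspace) topology: a subset of `S` is Euclidean-open iff it contains an open
`M_S`-ball around each of its points. -/
theorem sporadic_mS_topology_eq_euclidean
    (S : Set ℝ) (hS : Sporadic S) :
    ∀ u : Set S, IsOpen u ↔
      ∀ x ∈ u, ∃ ε > 0, ∀ y : S,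
        (if (x : ℝ) = (y : ℝ) then (0 : ℝ) else max (x : ℝ) (y : ℝ)) < ε →
          y ∈ u := by
  intro u
  rw [Metric.isOpen_iff]
  refine forall₂_congr fun x hx => ?_
  have hx_nonneg := hS.nonneg x.2
  constructor
  · rintro ⟨ε, hε, hu⟩
    rcases hx_nonneg.eq_or_lt with h0 | hpos
    · refine ⟨ε, hε, fun y hy => hu ?_⟩
      have hy_nonneg := hS.nonneg y.2
      rw [Metric.mem_ball, Subtype.dist_eq, Real.dist_eq, ← h0, sub_zero, abs_of_nonneg hy_nonneg]
      split_ifs at hy with h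
      · linarith
      · exact (le_max_right _ _).trans_lt hy
    · refine ⟨x, hpos, fun y hy => ?_⟩
      split_ifs at hy with h
      · rwa [← Subtype.ext h]
      · exact absurd hy (le_max_left _ _).not_gt
  · rintro ⟨ε, hε, hu⟩
    by_cases h0 : (x : ℝ) = 0
    · refine ⟨ε, hε, fun y hy => hu y ?_⟩
      have hy_nonneg := hS.nonneg y.2
      rw [Metric.mem_ball, Subtype.dist_eq, Real.dist_eq, h0, sub_zero,
        abs_of_nonneg hy_nonneg] at hy
      split_ifs
      · exact hε
      · exact max_lt (h0 ▸ hε) hy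
    · obtain ⟨δ, hδ, h⟩ := hS.exists_forall_dist_lt_eq x.2 h0
      refine ⟨δ, hδ, fun y hy => ?_⟩
      rwa [Subtype.ext (h y y.2 hy)]
end

section
/- Let X be a metrizable topological space, let f : X → [0, ∞) be a continuous proper function, and let d be a metric on X generating the topology of X. Define E[f](x, y) = |f(x) − f(y)| and D(x, y) = max(d(x, y), E[f](x, y)). Then D is a metric on X generating the topology of X, and D is a proper metric (every bounded closed subset of (X, D) is compact). -/
/-- **Making a metric proper using a proper function.** Let `X` be a metrizable
space, `f : X → [0, ∞)` a continuous proper function, and `d` a metric on `X`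
generating its topology. Then `D(x, y) = max (d x y) |f x − f y|` is a metric on
`X` generating its topology, and `D` is proper. -/
theorem max_metric_proper_of_proper_function
    {X : Type*} [TopologicalSpace X] [TopologicalSpace.MetrizableSpace X]
    (f : X → ℝ) (hf0 : ∀ x, 0 ≤ f x) (hfc : Continuous f)
    (hfp : ∀ K : Set ℝ, IsCompact K → IsCompact (f ⁻¹' K))
    (d : X → X → ℝ) (hd : IsMetricGen d) :
    IsMetricGen (fun x y => max (d x y) |f x - f y|) ∧
      IsProperMetric (fun x y => max (d x y) |f x - f y|) := by
  obtain ⟨hnonneg, hzero, hsymm, htri, hopen⟩ := hd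
  refine ⟨⟨fun x y => le_max_of_le_left (hnonneg x y), fun x y => ⟨fun h => ?_, ?_⟩,
    fun x y => ?_, fun x y z => ?_, fun s => ⟨fun hs x hx => ?_, fun hs => ?_⟩⟩, ?_⟩
  · exact (hzero x y).1 (le_antisymm ((le_max_left _ _).trans h.le) (hnonneg x y))
  · rintro rfl
    simp [(hzero x x).2 rfl]
  · simp only [hsymm x y, abs_sub_comm (f x) (f y)]
  · exact max_le ((htri x y z).trans (add_le_add (le_max_left _ _) (le_max_left _ _)))
      ((abs_sub_le (f x) (f y) (f z)).trans (add_le_add (le_max_right _ _) (le_max_right _ _)))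
  · obtain ⟨ε, hε, h⟩ := (hopen s).1 hs x hx
    exact ⟨ε, hε, fun y hy => h y ((le_max_left _ _).trans_lt hy)⟩
  · refine (hopen s).2 fun x hx => ?_
    obtain ⟨ε, hε, h⟩ := hs x hx
    have hU : IsOpen {y | |f x - f y| < ε} :=
      isOpen_lt (continuous_const.sub hfc).abs continuous_const
    obtain ⟨δ, hδ, hball⟩ := (hopen _).1 hU x (by simpa using hε)
    exact ⟨min ε δ, lt_min hε hδ, fun y hy => h y (max_lt (hy.trans_le (min_le_left _ _))
      (hball y (hy.trans_le (min_le_right _ _))))⟩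
  · rintro s hs ⟨C, hC⟩
    rcases s.eq_empty_or_nonempty with rfl | ⟨x, hx⟩
    · exact isCompact_empty
    · refine (hfp (Set.Icc 0 (f x + C)) isCompact_Icc).of_isClosed_subset hs fun y hy => ?_
      have hxy := (abs_le.1 ((le_max_right _ _).trans (hC x hx y hy))).1
      exact ⟨hf0 y, by linarith⟩
end

section
/- Let X be a σ-compact locally compact metrizable topological space. Then there exists a proper metric on X generating the topology of X. In particular, X is completely metrizable. -/
/-- A metric is complete if every Cauchy sequence converges. -/
def IsCompleteMetric {X : Type*} (d : X → X → ℝ) : Prop :=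
  ∀ u : ℕ → X, (∀ ε : ℝ, 0 < ε → ∃ N, ∀ m ≥ N, ∀ n ≥ N, d (u m) (u n) < ε) →
    ∃ x : X, ∀ ε : ℝ, 0 < ε → ∃ N, ∀ n ≥ N, d x (u n) < ε

/-- Along a compact exhaustion of a normal paracompact space, some continuous function dominates
the index at which points enter the exhaustion. -/
lemma CompactExhaustion.exists_continuous_find_le {X : Type*} [TopologicalSpace X] [NormalSpace X]
    [ParacompactSpace X] (K : CompactExhaustion X) :
    ∃ f : C(X, ℝ), ∀ x, (K.find x : ℝ) ≤ f x := by
  refine exists_continuous_forall_mem_convex_of_local_const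
    (t := fun x => Set.Ici (K.find x : ℝ)) (fun x => convex_Ici _) fun x => ?_
  obtain ⟨n, hn⟩ := K.exists_mem_nhds x
  refine ⟨n, ?_⟩
  filter_upwards [hn] with y hy
  exact (Nat.cast_le (α := ℝ)).2 (K.mem_iff_find_le.1 hy)

/-- The distance `dist x y + |f x - f y|` generates the topology when `f` is continuous. -/
lemma isMetricGen_dist_add_abs_sub {X : Type*} [MetricSpace X] {f : X → ℝ} (hf : Continuous f) :
    IsMetricGen fun x y => dist x y + |f x - f y| := by
  refine ⟨fun x y => by positivity, fun x y => ⟨fun h => ?_, ?_⟩, fun x y => ?_,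
    fun x y z => ?_, fun s => ⟨fun hs x hx => ?_, fun h => ?_⟩⟩
  · exact dist_le_zero.1 (by linarith [abs_nonneg (f x - f y)])
  · rintro rfl
    simp
  · simp only [dist_comm x y, abs_sub_comm (f x) (f y)]
  · linarith [dist_triangle x y z, abs_sub_le (f x) (f y) (f z)]
  · obtain ⟨ε, hε, hs⟩ := Metric.isOpen_iff.1 hs x hx
    exact ⟨ε, hε, fun y hy => hs (Metric.mem_ball'.2 (by linarith [abs_nonneg (f x - f y)]))⟩
  · refine isOpen_iff_mem_nhds.2 fun x hx => ?_
    obtain ⟨ε, hε, hs⟩ := h x hx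
    have hcont : Continuous fun y => dist x y + |f x - f y| := by fun_prop
    filter_upwards [hcont.continuousAt.eventually_lt_const (by simpa using hε)] with y hy
    exact hs y hy

/-- If a compact set contains each sublevel set of `f`, then `dist x y + |f x - f y|` is proper. -/
lemma isProperMetric_dist_add_abs_sub {X : Type*} [MetricSpace X] {f : X → ℝ}
    (hf : ∀ r, ∃ k : Set X, IsCompact k ∧ ∀ x, f x ≤ r → x ∈ k) :
    IsProperMetric fun x y => dist x y + |f x - f y| := by
  rintro s hs ⟨C, hC⟩
  rcases s.eq_empty_or_nonempty with rfl | ⟨x, hx⟩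
  · exact isCompact_empty
  obtain ⟨k, hk, hkf⟩ := hf (f x + C)
  refine hk.of_isClosed_subset hs fun y hy => hkf y ?_
  linarith [hC x hx y hy, neg_abs_le (f x - f y), dist_nonneg (x := x) (y := y)]

/-- If a compact set contains each sublevel set of a continuous `f`, then
`dist x y + |f x - f y|` is complete. -/
lemma isCompleteMetric_dist_add_abs_sub {X : Type*} [MetricSpace X] {f : X → ℝ}
    (hcont : Continuous f) (hf : ∀ r, ∃ k : Set X, IsCompact k ∧ ∀ x, f x ≤ r → x ∈ k) :
    IsCompleteMetric fun x y => dist x y + |f x - f y| := by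
  intro u hu
  have hcauchy : CauchySeq u := by
    refine Metric.cauchySeq_iff.2 fun ε hε => ?_
    obtain ⟨N, hN⟩ := hu ε hε
    exact ⟨N, fun m hm n hn => by linarith [hN m hm n hn, abs_nonneg (f (u m) - f (u n))]⟩
  obtain ⟨N, hN⟩ := hu 1 one_pos
  obtain ⟨k, hk, hkf⟩ := hf (f (u N) + 1)
  have hmem : ∀ n, u (n + N) ∈ k := fun n => hkf _ <| by
    linarith [hN N le_rfl (n + N) (Nat.le_add_left _ _), neg_abs_le (f (u N) - f (u (n + N))),
      dist_nonneg (x := u N) (y := u (n + N))]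
  obtain ⟨a, -, ha⟩ := cauchySeq_tendsto_of_isComplete hk.isComplete hmem
    (hcauchy.comp_tendsto (Filter.tendsto_add_atTop_nat N))
  have hlim : Filter.Tendsto u Filter.atTop (nhds a) :=
    (Filter.tendsto_add_atTop_iff_nat N).1 ha
  have hdist : Continuous fun y => dist a y + |f a - f y| := by fun_prop
  refine ⟨a, fun ε hε => Filter.eventually_atTop.1 ?_⟩
  exact (hdist.continuousAt.tendsto.comp hlim).eventually_lt_const (by simpa using hε)

/-- **Existence of proper metrics.** Every σ-compact locally compact metrizable
space admits a proper metric generating its topology; in particular (since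
proper metrics are complete) it is completely metrizable. -/
theorem exists_proper_metric
    {X : Type*} [TopologicalSpace X] [TopologicalSpace.MetrizableSpace X]
    [SigmaCompactSpace X] [LocallyCompactSpace X] :
    ∃ D : X → X → ℝ, IsMetricGen D ∧ IsProperMetric D ∧ IsCompleteMetric D := by
  let _ : MetricSpace X := TopologicalSpace.metrizableSpaceMetric X
  let K := CompactExhaustion.choice X
  obtain ⟨f, hf⟩ := K.exists_continuous_find_le
  have hsub : ∀ r, ∃ k : Set X, IsCompact k ∧ ∀ x, f x ≤ r → x ∈ k := fun r =>
    ⟨K ⌊r⌋₊, K.isCompact _, fun x hx => K.mem_iff_find_le.2 (Nat.le_floor ((hf x).trans hx))⟩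
  exact ⟨fun x y => dist x y + |f x - f y|, isMetricGen_dist_add_abs_sub f.continuous,
    isProperMetric_dist_add_abs_sub hsub, isCompleteMetric_dist_add_abs_sub f.continuous hsub⟩
end

section
/- Let (X, d) be an ultrametric space, let A be a non-empty closed subset of X, and let τ ∈ (1, ∞). Then there exists a τ²-Lipschitz retraction r : X → A (i.e., d(r(x), r(y)) ≤ τ² d(x, y) for all x, y ∈ X and r(a) = a for all a ∈ A). Moreover, if A is unbounded, then r is metrically proper: for every bounded subset B of A, the inverse image r⁻¹(B) is bounded in X. -/
open Metric

/-- In an ultrametric space, the distance to a set does not decrease when moving from `x` by less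
than the distance from `x` to the set. -/
theorem infDist_le_infDist_of_dist_lt {X : Type*} [PseudoMetricSpace X] [IsUltrametricDist X]
    {A : Set X} (hne : A.Nonempty) {x y : X} (h : dist x y < infDist x A) :
    infDist x A ≤ infDist y A := by
  refine (le_infDist hne).2 fun a ha => ?_
  have hmax := (infDist_le_dist_of_mem ha).trans (dist_triangle_max x y a)
  exact (le_max_iff.1 hmax).resolve_left h.not_ge

/-- In an ultrametric space, the distance to a set is locally constant away from the closure of
the set. -/
theorem infDist_eq_infDist_of_dist_lt {X : Type*} [PseudoMetricSpace X] [IsUltrametricDist X]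
    {A : Set X} (hne : A.Nonempty) {x y : X} (h : dist x y < infDist x A) :
    infDist x A = infDist y A := by
  have hle := infDist_le_infDist_of_dist_lt hne h
  refine hle.antisymm (infDist_le_infDist_of_dist_lt hne ?_)
  rw [dist_comm]
  exact h.trans_le hle

/-- A non-empty bounded set contains a point whose distance to `p` is maximal up to `1`. -/
theorem exists_mem_forall_dist_le_add_one {X : Type*} [PseudoMetricSpace X] (p : X) {C : Set X}
    (hC : C.Nonempty) (hb : Bornology.IsBounded C) :
    ∃ c ∈ C, ∀ b ∈ C, dist b p ≤ dist c p + 1 := by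
  obtain ⟨R, hR⟩ := hb.subset_closedBall p
  have hbdd : BddAbove ((dist · p) '' C) := ⟨R, by rintro _ ⟨c, hc, rfl⟩; exact hR hc⟩
  obtain ⟨_, ⟨c, hc, rfl⟩, hlt⟩ :=
    exists_lt_of_lt_csSup (hC.image (dist · p)) (sub_one_lt (sSup ((dist · p) '' C)))
  refine ⟨c, hc, fun b hbC => ?_⟩
  have hle := le_csSup hbdd (Set.mem_image_of_mem (dist · p) hbC)
  dsimp only at hle hlt
  linarith

/-- A non-empty closed set meets the closed ball around `x` whose radius is `τ > 1` times the
distance from `x` to the set. -/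
theorem inter_closedBall_mul_infDist_nonempty {X : Type*} [PseudoMetricSpace X] {A : Set X}
    (hA : IsClosed A) (hne : A.Nonempty) {τ : ℝ} (hτ : 1 < τ) (x : X) :
    (A ∩ closedBall x (τ * infDist x A)).Nonempty := by
  rcases (infDist_nonneg (x := x) (s := A)).eq_or_lt with h | h
  · refine ⟨x, (hA.mem_iff_infDist_zero hne).2 h.symm, mem_closedBall_self ?_⟩
    simp [← h]
  · obtain ⟨a, ha, hlt⟩ := (infDist_lt_iff hne).1 (lt_mul_of_one_lt_left h hτ)
    exact ⟨a, ha, by rw [mem_closedBall']; exact hlt.le⟩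

/-- In an ultrametric space, if `r x` depends only on the closed ball around `x` of radius `τ`
times the distance from `x` to `A`, and lies in that ball, then `r` is `τ`-Lipschitz. -/
theorem dist_le_mul_dist_of_mem_closedBall_infDist {X : Type*} [PseudoMetricSpace X]
    [IsUltrametricDist X] {A : Set X} (hne : A.Nonempty) {τ : ℝ} (hτ : 1 < τ)
    {r : X → X} (hr : ∀ x, r x ∈ closedBall x (τ * infDist x A))
    (hconst : ∀ x y, closedBall x (τ * infDist x A) = closedBall y (τ * infDist y A) → r x = r y)
    (x y : X) : dist (r x) (r y) ≤ τ * dist x y := by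
  have hτ0 : 0 ≤ τ := by linarith
  have key : ∀ x y, dist x y < infDist x A → r x = r y := fun x y h => by
    refine hconst x y ?_
    rw [← infDist_eq_infDist_of_dist_lt hne h]
    refine IsUltrametricDist.closedBall_eq_of_mem ?_
    rw [mem_closedBall']
    exact h.le.trans (le_mul_of_one_le_left infDist_nonneg hτ.le)
  rcases lt_or_ge (dist x y) (infDist x A) with hx | hx
  · rw [key x y hx, dist_self]
    positivity
  rcases lt_or_ge (dist x y) (infDist y A) with hy | hy
  · rw [key y x (by rwa [dist_comm]), dist_self]
    positivity
  have h₁ : dist (r x) x ≤ τ * dist x y :=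
    (mem_closedBall.1 (hr x)).trans (mul_le_mul_of_nonneg_left hx hτ0)
  have h₂ : dist y (r y) ≤ τ * dist x y :=
    (mem_closedBall'.1 (hr y)).trans (mul_le_mul_of_nonneg_left hy hτ0)
  have h₃ : dist x y ≤ τ * dist x y := le_mul_of_one_le_left dist_nonneg hτ.le
  exact (dist_triangle_max _ x _).trans
    (max_le h₁ ((dist_triangle_max _ y _).trans (max_le h₃ h₂)))

/-- **Lipschitz retractions onto closed subsets of ultrametric spaces.** Let
`(X, d)` be an ultrametric space, `A` a non-empty closed subset, and `τ > 1`.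
Then there exists a `τ²`-Lipschitz retraction `r : X → A`; moreover, if `A` is
unbounded, then `r` is metrically proper: preimages of bounded subsets of `A`
are bounded. -/
theorem ultrametric_lipschitz_retraction
    {X : Type*} [MetricSpace X] [IsUltrametricDist X]
    (A : Set X) (hA : IsClosed A) (hne : A.Nonempty)
    (τ : ℝ) (hτ : 1 < τ) :
    ∃ r : X → X, Continuous r ∧ (∀ x, r x ∈ A) ∧ (∀ a ∈ A, r a = a) ∧
      (∀ x y, dist (r x) (r y) ≤ τ ^ 2 * dist x y) ∧
      (¬ Bornology.IsBounded A →
        ∀ B : Set X, B ⊆ A → Bornology.IsBounded B →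
          Bornology.IsBounded (r ⁻¹' B)) := by
  obtain ⟨p, hp⟩ := hne
  let C : X → Set X := fun x => closedBall x (τ * infDist x A)
  have hC : ∀ x, (A ∩ C x).Nonempty := inter_closedBall_mul_infDist_nonempty hA ⟨p, hp⟩ hτ
  have hchoice : ∀ S : Set X, ∃ c, (A ∩ S).Nonempty → Bornology.IsBounded S →
      c ∈ A ∩ S ∧ ∀ b ∈ A ∩ S, dist b p ≤ dist c p + 1 := fun S => by
    by_cases h : (A ∩ S).Nonempty ∧ Bornology.IsBounded S
    · obtain ⟨c, hc, hmax⟩ :=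
        exists_mem_forall_dist_le_add_one p h.1 (h.2.subset Set.inter_subset_right)
      exact ⟨c, fun _ _ => ⟨hc, hmax⟩⟩
    · exact ⟨p, fun h₁ h₂ => (h ⟨h₁, h₂⟩).elim⟩
  choose f hf using hchoice
  have hmem : ∀ x, f (C x) ∈ A ∩ C x := fun x => (hf _ (hC x) isBounded_closedBall).1
  have hmax : ∀ x, ∀ b ∈ A ∩ C x, dist b p ≤ dist (f (C x)) p + 1 :=
    fun x => (hf _ (hC x) isBounded_closedBall).2
  have hlip : ∀ x y, dist (f (C x)) (f (C y)) ≤ τ * dist x y :=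
    dist_le_mul_dist_of_mem_closedBall_infDist (r := fun x => f (C x)) ⟨p, hp⟩ hτ
      (fun x => (hmem x).2) (fun _ _ h => congrArg f h)
  refine ⟨fun x => f (C x), ?_, fun x => (hmem x).1, fun a ha => ?_, fun x y => ?_, ?_⟩
  · exact (LipschitzWith.of_dist_le_mul (K := τ.toNNReal) fun x y => by
      rw [Real.coe_toNNReal τ (by linarith)]
      exact hlip x y).continuous
  · simpa [C, infDist_zero_of_mem ha] using (hmem a).2
  · exact (hlip x y).trans (mul_le_mul_of_nonneg_right (by nlinarith) dist_nonneg)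
  · intro hunb B _ hB
    obtain ⟨R, hR⟩ := hB.subset_closedBall p
    obtain ⟨b, hbA, hb⟩ : ∃ b ∈ A, R + 1 < dist b p := by
      by_contra! h
      exact hunb (isBounded_closedBall.subset (fun b hb => mem_closedBall.2 (h b hb)))
    refine (isBounded_closedBall (x := p) (r := dist b p)).subset fun x hx => ?_
    have hxR : dist (f (C x)) p ≤ R := hR hx
    have hbC : b ∉ C x := fun h => by linarith [hmax x b ⟨hbA, h⟩]
    have hfx : dist x (f (C x)) ≤ τ * infDist x A := mem_closedBall'.1 (hmem x).2
    rw [mem_closedBall]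
    rcases le_max_iff.1 (dist_triangle_max x (f (C x)) p) with h | h
    · by_contra! hlt
      refine hbC (mem_closedBall.2 ?_)
      rw [dist_comm x p] at *
      exact (dist_triangle_max b p x).trans (max_le (hlt.le.trans (h.trans hfx)) (h.trans hfx))
    · linarith
end

section
/- Let S be an unbounded characteristic subset of [0, ∞), let X be a strongly 0-dimensional, σ-compact, locally compact metrizable topological space, let d be an ultrametric on X taking values in S and generating the topology of X, and let T be a sporadic subset of [0, ∞) with T ⊆ S. Then there exists an ultrametric w on X taking values in T and generating the topology of X such that w(x, y) ≤ d(x, y) for all x, y ∈ X; moreover, if d is a proper metric, then so is w. -/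
namespace Sporadic

variable {T : Set ℝ}

lemma nonneg_s18 (hT : Sporadic T) {t : ℝ} (ht : t ∈ T) : 0 ≤ t := by
  obtain ⟨s, hs, rfl, h0, -⟩ := hT
  obtain rfl | ⟨n, rfl⟩ := ht
  · exact le_rfl
  · exact hs.monotone.le_of_tendsto h0 n

lemma zero_mem (hT : Sporadic T) : (0 : ℝ) ∈ T := by
  obtain ⟨s, -, rfl, -⟩ := hT
  exact Set.mem_insert _ _

/-- A sporadic set contains arbitrarily small positive elements. -/
lemma exists_mem_pos_le (hT : Sporadic T) {r : ℝ} (hr : 0 < r) : ∃ t ∈ T, 0 < t ∧ t ≤ r := by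
  obtain ⟨s, hs, rfl, h0, -⟩ := hT
  obtain ⟨n, hn⟩ := (h0.eventually (gt_mem_nhds hr)).exists
  exact ⟨s n, Or.inr ⟨n, rfl⟩,
    (hs.monotone.le_of_tendsto h0 (n - 1)).trans_lt (hs (by omega)), hn.le⟩

/-- A sporadic set contains arbitrarily large elements. -/
lemma exists_mem_gt (hT : Sporadic T) (C : ℝ) : ∃ t ∈ T, C < t := by
  obtain ⟨s, -, rfl, -, htop⟩ := hT
  obtain ⟨n, hn⟩ := (htop.eventually_gt_atTop C).exists
  exact ⟨s n, Or.inr ⟨n, rfl⟩, hn⟩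

/-- Every nonnegative number can be rounded down to an element of a sporadic set. -/
lemma exists_isGreatest (hT : Sporadic T) {r : ℝ} (hr : 0 ≤ r) :
    ∃ t, IsGreatest (T ∩ Set.Iic r) t := by
  obtain rfl | hr := hr.eq_or_lt
  · exact ⟨0, ⟨hT.zero_mem, Set.mem_Iic.2 le_rfl⟩, fun u hu => hu.2⟩
  obtain ⟨s, hs, rfl, h0, htop⟩ := id hT
  obtain ⟨N, hN⟩ := (htop.eventually_gt_atTop r).exists
  obtain ⟨n, hn⟩ := (h0.eventually (gt_mem_nhds hr)).exists
  obtain ⟨m, hm, hmax⟩ := Int.exists_greatest_of_bdd (P := fun k => s k ≤ r)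
    ⟨N, fun k hk => (hs.lt_iff_lt.1 (hk.trans_lt hN)).le⟩ ⟨n, hn.le⟩
  refine ⟨s m, ⟨Or.inr ⟨m, rfl⟩, hm⟩, ?_⟩
  rintro u ⟨rfl | ⟨k, rfl⟩, hu⟩
  · exact hT.nonneg_s18 (Or.inr ⟨m, rfl⟩)
  · exact hs.monotone (hmax k hu)

end Sporadic

/-- **Dominated sporadic-valued ultrametrics.** Let `S` be an unbounded
characteristic subset of `[0, ∞)`, `X` a strongly 0-dimensional σ-compact
locally compact metrizable space, `d` an `S`-valued ultrametric generating the
topology of `X`, and `T ⊆ S` sporadic. Then there exists a `T`-valued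
ultrametric `w` generating the topology of `X` with `w ≤ d` pointwise;
moreover, if `d` is proper then so is `w`. -/
theorem exists_dominated_sporadic_ultrametric
    {X : Type*} [TopologicalSpace X] [TopologicalSpace.MetrizableSpace X]
    [SigmaCompactSpace X] [LocallyCompactSpace X]
    (hX : StronglyZeroDimensional X)
    (S : Set ℝ) (hS : IsCharacteristic S) (hSu : ¬ BddAbove S)
    (d : X → X → ℝ) (hd : IsUltrametricGen d) (hdS : ∀ x y, d x y ∈ S)
    (T : Set ℝ) (hT : Sporadic T) (hTS : T ⊆ S) :
    ∃ w : X → X → ℝ, IsUltrametricGen w ∧ (∀ x y, w x y ∈ T) ∧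
      (∀ x y, w x y ≤ d x y) ∧
      (IsProperMetric d → IsProperMetric w) := by
  obtain ⟨d0, deq, dsymm, dtri, dtop⟩ := hd
  choose w hw using fun x y => hT.exists_isGreatest (d0 x y)
  have hwT (x y) : w x y ∈ T := (hw x y).1.1
  have hwd (x y) : w x y ≤ d x y := (hw x y).1.2
  have hle {x y} {t : ℝ} (ht : t ∈ T) (h : t ≤ d x y) : t ≤ w x y := (hw x y).2 ⟨ht, h⟩
  have hlt {x y} {t : ℝ} (ht : t ∈ T) (h : w x y < t) : d x y < t :=
    lt_of_not_ge fun h' => (hle ht h').not_gt h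
  refine ⟨w, ⟨fun x y => hT.nonneg_s18 (hwT x y), fun x y => ⟨fun h => ?_, ?_⟩, fun x y => ?_,
    fun x y z => ?_, fun s => ?_⟩, hwT, hwd, fun hp s hs ⟨C, hC⟩ => ?_⟩
  · by_contra hxy
    obtain ⟨t, ht, htpos, htd⟩ := hT.exists_mem_pos_le
      ((d0 x y).lt_of_ne fun h' => hxy ((deq x y).1 h'.symm))
    exact absurd (hle ht htd) (by rw [h]; exact htpos.not_ge)
  · rintro rfl
    exact le_antisymm ((hwd x x).trans ((deq x x).2 rfl).le) (hT.nonneg_s18 (hwT x x))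
  · exact le_antisymm (hle (hwT x y) ((hwd x y).trans (dsymm x y).le))
      (hle (hwT y x) ((hwd y x).trans (dsymm y x).le))
  · obtain h | h := le_max_iff.1 ((hwd x z).trans (dtri x y z))
    · exact le_max_of_le_left (hle (hwT x z) h)
    · exact le_max_of_le_right (hle (hwT x z) h)
  · refine (dtop s).trans (forall₂_congr fun x _ => ⟨?_, ?_⟩)
    · rintro ⟨ε, hε, h⟩
      obtain ⟨t, ht, htpos, htε⟩ := hT.exists_mem_pos_le hε
      exact ⟨t, htpos, fun y hy => h y ((hlt ht hy).trans_le htε)⟩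
    · rintro ⟨ε, hε, h⟩
      exact ⟨ε, hε, fun y hy => h y ((hwd x y).trans_lt hy)⟩
  · obtain ⟨t, ht, hCt⟩ := hT.exists_mem_gt C
    exact hp s hs ⟨t, fun x hx y hy => (hlt ht ((hC x hx y hy).trans_lt hCt)).le⟩
end
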